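/- Let μ be a singular cardinal of cofinality ω. The Baire number of the space U(μ) of uniform ultrafilters on μ — the least number of nowhere-dense sets needed to cover U(μ) — is exactly ω₂. -/

import Mathlib

open Cardinal Set

noncomputable section

/-- The space of uniform ultrafilters on a set of size `μ`. -/
def UnifUF (X : Type) (μ : Cardinal.{0}) : Type :=
  {F : Ultrafilter X // ∀ s : Set X, s ∈ F → Cardinal.mk s = μ}

/-- The usual topology on the space of uniform ultrafilters, generated by the
basic open sets `p̂ = {F : p ∈ F}` for `p ⊆ X` of size `μ`. -/
instance UnifUFTop (X : Type) (μ : Cardinal.{0}) : TopologicalSpace (UnifUF X μ) :=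
  TopologicalSpace.generateFrom
    {V | ∃ p : Set X, Cardinal.mk p = μ ∧ V = {F : UnifUF X μ | p ∈ F.1}}

namespace BN

/-- the basic data -/
structure Sys (X : Type) where
  μ : Cardinal.{0}
  m : ℕ → Cardinal.{0}
  bl : X → ℕ
  hm0 : ℵ_ 1 ≤ m 0
  hmono : Monotone m
  hlt : ∀ k, m k < μ
  hcof : ∀ c < μ, ∃ k, c < m k
  hbl : ∀ n, #{x | bl x = n} < μ

variable {X : Type} (M : Sys X)

def Sys.Big (q : Set X) : Prop := M.μ ≤ #q
def Sys.Small (q : Set X) : Prop := #q < M.μ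
/-- almost inclusion -/
def Sys.Le (q p : Set X) : Prop := #(q \ p : Set X) < M.μ
/-- block -/
def Sys.blk (q : Set X) (n : ℕ) : Set X := {x | x ∈ q ∧ M.bl x = n}

variable {M}

lemma aleph0_lt_aleph_one' : ℵ₀ < ℵ_ 1 := by simp

lemma Sys.m_ge (k : ℕ) : ℵ_ 1 ≤ M.m k := M.hm0.trans (M.hmono (Nat.zero_le k))
lemma Sys.aleph0_le_m (k : ℕ) : ℵ₀ ≤ M.m k := aleph0_lt_aleph_one'.le.trans (Sys.m_ge k)
lemma Sys.aleph1_lt : ℵ_ 1 < M.μ := (M.hm0).trans_lt (M.hlt 0)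
lemma Sys.aleph0_le : ℵ₀ ≤ M.μ := (aleph0_lt_aleph_one'.trans Sys.aleph1_lt).le

lemma Sys.big_iff {q : Set X} : M.Big q ↔ ∀ k, M.m k ≤ #q := by
  constructor
  · intro h k; exact (M.hlt k).le.trans h
  · intro h
    by_contra hc
    obtain ⟨k, hk⟩ := M.hcof _ (not_le.mp hc)
    exact absurd (h k) (not_le.mpr hk)

lemma Sys.not_big {q : Set X} : ¬ M.Big q ↔ M.Small q := not_le
lemma Sys.not_small {q : Set X} : ¬ M.Small q ↔ M.Big q := not_lt

lemma Sys.Small.mono {p q : Set X} (h : M.Small p) (hq : q ⊆ p) : M.Small q :=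
  (Cardinal.mk_le_mk_of_subset hq).trans_lt h
lemma Sys.Big.mono {p q : Set X} (h : M.Big p) (hq : p ⊆ q) : M.Big q :=
  le_trans h (Cardinal.mk_le_mk_of_subset hq)
lemma Sys.Small.union {p q : Set X} (h : M.Small p) (hq : M.Small q) : M.Small (p ∪ q) :=
  (Cardinal.mk_union_le p q).trans_lt (Cardinal.add_lt_of_lt Sys.aleph0_le h hq)
lemma Sys.small_empty : M.Small ∅ := by
  unfold Sys.Small; simpa using (aleph0_pos.trans_le Sys.aleph0_le)
lemma Sys.Big.nonempty {p : Set X} (h : M.Big p) : p.Nonempty := by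
  rw [nonempty_iff_ne_empty]; rintro rfl
  exact Sys.not_big.mpr Sys.small_empty h

lemma Sys.Le.of_subset {p q : Set X} (h : q ⊆ p) : M.Le q p := by
  unfold Sys.Le; rw [Set.sdiff_eq_empty.mpr h]; exact Sys.small_empty
lemma Sys.Le.refl (p : Set X) : M.Le p p := Sys.Le.of_subset (subset_refl p)
lemma Sys.Le.trans {p q r : Set X} (h : M.Le r q) (h' : M.Le q p) : M.Le r p := by
  refine Sys.Small.mono (Sys.Small.union h h') ?_
  intro x hx
  by_cases hq : x ∈ q
  · right; exact ⟨hq, hx.2⟩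
  · left; exact ⟨hx.1, hq⟩
lemma Sys.Small.of_le {p q : Set X} (h : M.Small p) (h' : M.Le q p) : M.Small q := by
  refine Sys.Small.mono (Sys.Small.union h h') ?_
  intro x hx
  by_cases hq : x ∈ p
  · left; exact hq
  · right; exact ⟨hx, hq⟩
lemma Sys.Big.of_diff {p q : Set X} (h : M.Big p) (h' : M.Small q) : M.Big (p \ q) := by
  by_contra hc
  rw [Sys.not_big] at hc
  refine Sys.not_big.mpr (Sys.Small.mono (hc.union h') ?_) h
  intro x hx
  by_cases hq : x ∈ q
  · right; exact hq
  · left; exact ⟨hx, hq⟩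
lemma Sys.Big.inter_of_le {p q : Set X} (h : M.Big q) (h' : M.Le q p) : M.Big (q ∩ p) := by
  have := Sys.Big.of_diff h h'
  refine this.mono ?_
  intro x hx; exact ⟨hx.1, by by_contra hc; exact hx.2 ⟨hx.1, hc⟩⟩

lemma Sys.small_of_countable_iUnion {ι : Type} [Countable ι] (s : ι → Set X) (k : ℕ)
    (h : ∀ i, #(s i) ≤ M.m k) : #(⋃ i, s i : Set X) ≤ M.m k := by
  refine (Cardinal.mk_iUnion_le s).trans ?_
  have h1 : #ι ≤ M.m k := (Cardinal.mk_le_aleph0).trans (Sys.aleph0_le_m k)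
  exact (mul_le_mul' h1 (ciSup_le' h)).trans
    (Cardinal.mul_eq_self (Sys.aleph0_le_m k)).le

lemma Sys.small_finite_iUnion {ι : Type} {I : Set ι} (hI : I.Finite) (s : ι → Set X)
    (h : ∀ i ∈ I, M.Small (s i)) : M.Small (⋃ i ∈ I, s i) := by
  induction I, hI using Set.Finite.induction_on with
  | empty => simpa using Sys.small_empty
  | insert ha hs ih =>
    rw [biUnion_insert]
    exact (h _ (mem_insert _ _)).union (ih fun i hi => h i (mem_insert_of_mem _ hi))

lemma Sys.small_le_m {q : Set X} (h : M.Small q) : ∃ k, #q ≤ M.m k := by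
  obtain ⟨k, hk⟩ := M.hcof _ h; exact ⟨k, hk.le⟩

/-- restricting to finitely many blocks is small -/
lemma Sys.small_blocks {I : Set ℕ} (hI : I.Finite) : M.Small {x | M.bl x ∈ I} := by
  have := Sys.small_finite_iUnion (M := M) hI (fun n => {x | M.bl x = n}) (fun i _ => M.hbl i)
  refine this.mono ?_
  intro x hx; simp at hx ⊢; exact hx

/-- big sets have infinitely many large blocks -/
lemma Sys.Big.blocks {q : Set X} (h : M.Big q) (k N : ℕ) : ∃ n ≥ N, M.m k < #(M.blk q n) := by
  by_contra! hc
  have h1 : M.Small {x | M.bl x ∈ Iio N} := Sys.small_blocks (finite_Iio N)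
  have h2 : #(⋃ n : {n // N ≤ n}, M.blk q n : Set X) ≤ M.m k :=
    Sys.small_of_countable_iUnion _ k (fun n => hc n.1 n.2)
  have h3 : M.Small (⋃ n : {n // N ≤ n}, M.blk q n : Set X) := h2.trans_lt (M.hlt k)
  refine Sys.not_big.mpr ((h1.union h3).mono ?_) h
  intro x hx
  rcases lt_or_ge (M.bl x) N with h | h
  · left; exact h
  · right; simp only [mem_iUnion]; exact ⟨⟨_, h⟩, hx, rfl⟩

lemma Sys.Big.seq {q : Set X} (h : M.Big q) (K : ℕ → ℕ) :
    ∃ b : ℕ → ℕ, StrictMono b ∧ ∀ k, M.m (K k) < #(M.blk q (b k)) := by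
  choose f hf hf' using fun k N => h.blocks (K k) N
  let b : ℕ → ℕ := fun k => Nat.rec (f 0 0) (fun k v => f (k+1) (v+1)) k
  refine ⟨b, strictMono_nat_of_lt_succ fun k => ?_, fun k => ?_⟩
  · exact hf (k+1) (b k + 1)
  · cases k with
    | zero => exact hf' 0 0
    | succ k => exact hf' (k+1) (b k + 1)

lemma Sys.blk_subset (q : Set X) (n : ℕ) : M.blk q n ⊆ q := fun _ h => h.1

lemma Sys.big_of_blocks {q : Set X} (b : ℕ → ℕ) (h : ∀ k, M.m k ≤ #(M.blk q (b k))) : M.Big q :=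
  Sys.big_iff.mpr fun k => (h k).trans (Cardinal.mk_le_mk_of_subset (Sys.blk_subset _ _))

lemma Sys.big_of_blocks' {q : Set X} (h : ∀ k, ∃ n, M.m k ≤ #(M.blk q n)) : M.Big q := by
  choose b hb using h; exact Sys.big_of_blocks b hb

/-- homogenization -/
lemma Sys.Big.homog {q : Set X} (h : M.Big q) {Z : Type} (χ : X → Z) (hZ : #Z < M.μ) :
    ∃ q' ⊆ q, M.Big q' ∧ ∃ ζ : ℕ → Z, ∀ x ∈ q', χ x = ζ (M.bl x) := by
  obtain ⟨k0, hk0⟩ := M.hcof _ hZ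
  obtain ⟨b, hb, hb'⟩ := h.seq (fun k => max k k0)
  have key : ∀ k, ∃ z, M.m k < #({x | x ∈ M.blk q (b k) ∧ χ x = z} : Set X) := by
    intro k
    by_contra! hc
    have : M.blk q (b k) = ⋃ z, {x | x ∈ M.blk q (b k) ∧ χ x = z} := by
      ext x; simp
    have h1 : #(M.blk q (b k)) ≤ M.m (max k k0) := by
      rw [this]
      refine (Cardinal.mk_iUnion_le _).trans ?_
      refine (mul_le_mul' (hk0.le.trans (M.hmono (le_max_right k k0)))
        (ciSup_le' fun z => (hc z).trans (M.hmono (le_max_left k k0)))).trans ?_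
      exact (Cardinal.mul_eq_self (Sys.aleph0_le_m _)).le
    exact absurd h1 (not_le.mpr (hb' k))
  choose z hz using key
  obtain ⟨x0, -⟩ := h.nonempty
  refine ⟨{x | ∃ k, x ∈ M.blk q (b k) ∧ χ x = z k}, ?_, ?_, ?_⟩
  · rintro x ⟨k, hk, -⟩; exact hk.1
  · refine Sys.big_iff.mpr fun k => (hz k).le.trans (Cardinal.mk_le_mk_of_subset ?_)
    intro x hx; exact ⟨k, hx⟩
  · refine ⟨fun n => z (Function.invFun b n), ?_⟩
    rintro x ⟨k, hk, hx⟩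
    show _ = z (Function.invFun b (M.bl x))
    rw [hx, hk.2, Function.leftInverse_invFun hb.injective k]

/-- σ-closure -/
lemma Sys.lower_bound (q : ℕ → Set X) (hq : ∀ k, M.Big (q k)) (hle : ∀ k, M.Le (q (k+1)) (q k)) :
    ∃ r ⊆ q 0, M.Big r ∧ ∀ k, M.Le r (q k) := by
  have hle' : ∀ j k, j ≤ k → M.Le (q k) (q j) := by
    intro j k hjk
    induction k, hjk using Nat.le_induction with
    | base => exact Sys.Le.refl _
    | succ k _ ih => exact (hle k).trans ih
  have hI : ∀ k, M.Big {x | ∀ j ≤ k, x ∈ q j} := by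
    intro k
    have h1 : M.Small (⋃ j ∈ Iic k, (q k \ q j)) :=
      Sys.small_finite_iUnion (finite_Iic k) _ (fun j hj => hle' j k hj)
    refine (Sys.Big.of_diff (hq k) h1).mono ?_
    intro x hx j hj
    by_contra hc
    exact hx.2 (by simp only [mem_iUnion]; exact ⟨j, hj, hx.1, hc⟩)
  have hB : ∀ k, ∃ B ⊆ {x | ∀ j ≤ k, x ∈ q j}, #B = M.m k := by
    intro k
    exact Cardinal.le_mk_iff_exists_subset.mp (Sys.big_iff.mp (hI k) k)
  choose B hB hB' using hB
  refine ⟨⋃ k, B k, ?_, ?_, ?_⟩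
  · intro x hx; obtain ⟨k, hk⟩ := mem_iUnion.mp hx; exact hB k hk 0 (Nat.zero_le _)
  · exact Sys.big_iff.mpr fun k => (hB' k).ge.trans
      (Cardinal.mk_le_mk_of_subset (subset_iUnion B k))
  · intro k
    have h1 : M.Small (⋃ j ∈ Iio k, B j) :=
      Sys.small_finite_iUnion (finite_Iio k) _ (fun j _ => by
        unfold Sys.Small; rw [hB']; exact M.hlt j)
    refine h1.mono ?_
    rintro x ⟨hx, hx'⟩
    obtain ⟨j, hj⟩ := mem_iUnion.mp hx
    have : j < k := by
      by_contra hc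
      exact hx' (hB j hj k (not_lt.mp hc))
    simp only [mem_iUnion]; exact ⟨j, this, hj⟩

/-- elements with large initial segments -/
lemma exists_large_Iio [LinearOrder X] [WellFoundedLT X] (s : Set X) (c : Cardinal.{0})
    (h : c < #s) : ∃ x ∈ s, c ≤ #(s ∩ Iio x : Set X) := by
  by_contra! hc
  have : Ordinal.type (fun a b : s => a < b) ≤ c.ord := by
    rw [← not_lt, ← Ordinal.type_toType c.ord]
    intro hlt
    have := Ordinal.typein_surj (fun a b : s => a < b) (o := c.ord) (by simpa using hlt)
    obtain ⟨a, ha⟩ := this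
    have h2 := hc a a.2
    have h3 : (Ordinal.typein (fun a b : s => a < b) a).card = c := by rw [ha]; simp
    have h4 : (Ordinal.typein (fun a b : s => a < b) a).card = #(s ∩ Iio (a:X) : Set X) := by
      rw [Ordinal.card_typein]
      refine Cardinal.mk_congr ⟨fun y => ⟨y.1.1, y.1.2, y.2⟩, fun y => ⟨⟨y.1, y.2.1⟩, y.2.2⟩,
        fun _ => rfl, fun _ => rfl⟩
    rw [← h4, h3] at h2
    exact lt_irrefl _ h2
  have h5 := Ordinal.card_le_card this
  simp at h5
  exact absurd h5 (not_le.mpr h)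

/-- no monotone counters below a σ-closed order -/
lemma no_mono {Q Z : Type} [Countable Z] [Nonempty Z] (R : Q → Q → Prop)
    (htr : ∀ u v w, R w v → R v u → R w u) (hrefl : ∀ u, R u u)
    (hσ : ∀ u : ℕ → Q, (∀ k, R (u (k+1)) (u k)) → ∃ v, ∀ k, R v (u k))
    (N : Q → Z → ℕ) (hN : ∀ u v z, R v u → N u z ≤ N v z) (u0 : Q) :
    ∃ u, ∀ v, R v u → ∀ z, N v z = N u z := by
  have step : ∀ u z, ∃ v, R v u ∧ ∀ w, R w v → N w z = N v z := by
    intro u z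
    by_contra! hc
    have hc' : ∀ v : {v // R v u}, ∃ w : {v // R v u}, R w.1 v.1 ∧ N v.1 z < N w.1 z := by
      rintro ⟨v, hv⟩
      obtain ⟨w, hw, hne⟩ := hc v hv
      exact ⟨⟨w, htr _ _ _ hw hv⟩, hw, lt_of_le_of_ne (hN _ _ _ hw) (Ne.symm hne)⟩
    choose f hf hf' using hc'
    let s : ℕ → {v // R v u} := fun k => f^[k] ⟨u, hrefl u⟩
    have hs : ∀ k, s (k+1) = f (s k) := fun k => Function.iterate_succ_apply' f k _
    obtain ⟨v, hv⟩ := hσ (fun k => (s k).1) (fun k => by rw [hs]; exact hf _)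
    have h1 : ∀ k, k ≤ N (s k).1 z := by
      intro k
      induction k with
      | zero => exact Nat.zero_le _
      | succ k ih => rw [hs]; exact lt_of_le_of_lt ih (hf' _)
    have h2 := h1 (N v z + 1)
    have h3 := hN _ _ z (hv (N v z + 1))
    omega
  choose g hg hg' using step
  obtain ⟨e, he⟩ := exists_surjective_nat Z
  let s : ℕ → Q := fun k => Nat.rec u0 (fun k v => g v (e k)) k
  obtain ⟨v, hv⟩ := hσ s (fun k => hg (s k) (e k))
  refine ⟨v, fun w hw z => ?_⟩
  obtain ⟨k, rfl⟩ := he z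
  have h1 := hg' (s k) (e k) w (htr _ _ _ hw (hv (k+1)))
  have h2 := hg' (s k) (e k) v (hv (k+1))
  rw [h1, h2]

end BN
namespace BN
set_option linter.unusedSectionVars false
set_option linter.deprecated false

/-- the first uncountable ordinal as a type -/
abbrev W : Type := (ℵ_ 1).ord.ToType

lemma mk_W : #W = ℵ_ 1 := Cardinal.mk_ord_toType _

lemma W_countable_Iio (i : W) : (Iio i).Countable := by
  have := Cardinal.mk_Iio_toType_ord_lt i
  rw [← Cardinal.le_aleph0_iff_set_countable]
  exact Order.lt_succ_iff.mp (this.trans_eq Cardinal.succ_aleph0.symm)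

lemma W_countable_Iic (i : W) : (Iic i).Countable := by
  rw [← Iio_insert]; exact (W_countable_Iio i).insert _

lemma W_not_countable {s : Set W} (hs : s.Countable) : ∃ i, i ∉ s := by
  by_contra! hc
  have : s = Set.univ := eq_univ_of_forall hc
  subst this
  have h1 := (Cardinal.le_aleph0_iff_set_countable).mpr hs
  rw [Cardinal.mk_univ, mk_W] at h1
  exact absurd h1 (not_le.mpr aleph0_lt_aleph_one')

lemma W_bound {s : Set W} (hs : s.Countable) : ∃ b, ∀ x ∈ s, x < b := by
  have h1 : (⋃ x ∈ s, Iic x).Countable := hs.biUnion fun x _ => W_countable_Iic x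
  obtain ⟨b, hb⟩ := W_not_countable h1
  refine ⟨b, fun x hx => ?_⟩
  by_contra hc
  exact hb (by simp only [mem_iUnion]; exact ⟨x, hx, not_lt.mp hc⟩)

/-- countable lower sets are initial segments -/
lemma W_lower {s : Set W} (hs : s.Countable) (hl : IsLowerSet s) : ∃ a, s = Iio a := by
  have hne : (sᶜ).Nonempty := W_not_countable hs
  refine ⟨wellFounded_lt.min sᶜ hne, ?_⟩
  ext x
  constructor
  · intro hx
    by_contra hc
    exact (wellFounded_lt.min_mem sᶜ hne) (hl (not_lt.mp hc) hx)
  · intro hx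
    by_contra hc
    exact wellFounded_lt.not_lt_min sᶜ hc hx

variable {X : Type} [LinearOrder X] [WellFoundedLT X] (M : Sys X)

abbrev Lab (X : Type) := ℕ → X

def Sys.C (σ : W → Lab X) (i : W) (ℓ : Lab X) : Set X :=
  {x | x < ℓ (M.bl x) ∧ ∀ j < i, x < σ j (M.bl x) → ℓ (M.bl x) < σ j (M.bl x)}

variable {M}

lemma Sys.C_congr {σ τ : W → Lab X} {i : W} (h : ∀ j < i, σ j = τ j) : M.C σ i = M.C τ i := by
  funext ℓ; ext x
  simp only [Sys.C, mem_ofPred_eq]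
  refine and_congr_right fun _ => forall₂_congr fun j hj => ?_
  rw [h j hj]

/-- each point is in finitely many of the sets -/
lemma Sys.C_finite (σ : W → Lab X) (x : X) : {i | x ∈ M.C σ i (σ i)}.Finite := by
  by_contra hinf
  have hinf : {i | x ∈ M.C σ i (σ i)}.Infinite := hinf
  have hmono : StrictAntiOn (fun i => σ i (M.bl x)) {i | x ∈ M.C σ i (σ i)} := by
    intro i hi j hj hij
    exact hj.2 i hij hi.1
  have : ∃ f : ℕ → W, StrictMono f ∧ ∀ k, f k ∈ {i | x ∈ M.C σ i (σ i)} := by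
    have hs := hinf.to_subtype
    obtain ⟨f, hf⟩ := exists_increasing_or_nonincreasing_subseq
      (· < ·) (fun k => ((Infinite.natEmbedding _ k : {i | x ∈ M.C σ i (σ i)}) : W))
    rcases hf with hf | hf
    · exact ⟨fun k => (Infinite.natEmbedding _ (f k) : {i | x ∈ M.C σ i (σ i)}),
        fun a b hab => hf a b hab, fun k => Subtype.coe_prop _⟩
    · exfalso
      let g : ℕ → W := fun k => (Infinite.natEmbedding _ (f k) : {i | x ∈ M.C σ i (σ i)})
      have hg : StrictAnti g := by
        intro a b hab
        refine lt_of_le_of_ne (not_lt.mp (hf a b hab)) ?_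
        intro he
        have := (Infinite.natEmbedding _).injective (Subtype.ext he)
        exact absurd (f.injective this) hab.ne'
      exact (RelEmbedding.natGT g (fun n => hg (Nat.lt_succ_self n))).not_wellFounded
        wellFounded_lt
  obtain ⟨f, hf, hf'⟩ := this
  exact (RelEmbedding.natGT (fun k => σ (f k) (M.bl x))
    (fun n => hmono (hf' n) (hf' (n+1)) (hf (Nat.lt_succ_self n)))).not_wellFounded wellFounded_lt

lemma Sys.C_progress (σ : W → Lab X) (i : W) {q : Set X} (hq : M.Big q) :
    ∃ ℓ, M.Big (q ∩ M.C σ i ℓ) := by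
  have h1 : ∀ x : X, ∃ o : Option (Iio i), (o = none → ∀ j < i, ¬ x < σ j (M.bl x)) ∧
      ∀ j, o = some j → x < σ j.1 (M.bl x) ∧ ∀ j' < i, x < σ j' (M.bl x) →
        σ j.1 (M.bl x) ≤ σ j' (M.bl x) := by
    intro x
    by_cases h : ∃ j < i, x < σ j (M.bl x)
    · let s : Set X := {y | x < y ∧ ∃ j < i, y = σ j (M.bl x)}
      have hs : s.Nonempty := by
        obtain ⟨j, hj, hx⟩ := h; exact ⟨_, hx, j, hj, rfl⟩
      obtain ⟨hm1, j, hj, hm2⟩ := wellFounded_lt.min_mem s hs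
      refine ⟨some ⟨j, hj⟩, by simp, ?_⟩
      rintro j1 hj1
      obtain rfl := Option.some.inj hj1
      simp only
      rw [← hm2]
      refine ⟨hm1, fun j' hj' hx => ?_⟩
      exact not_lt.mp (wellFounded_lt.not_lt_min s ⟨hx, j', hj', rfl⟩)
    · push Not at h
      exact ⟨none, by intro _ j hj; exact not_lt.mpr (h j hj), by simp⟩
  choose χ hχ hχ' using h1
  have hZ : #(Option (Iio i)) < M.μ := by
    have : Countable (Iio i) := (W_countable_Iio i).to_subtype
    exact (Cardinal.mk_le_aleph0).trans_lt (aleph0_lt_aleph_one'.trans Sys.aleph1_lt)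
  obtain ⟨q', hq', hb, ζ, hζ⟩ := hq.homog χ hZ
  obtain ⟨b, hbm, hbk⟩ := hb.seq id
  have h2 : ∀ k, ∃ x ∈ M.blk q' (b k), M.m k ≤ #(M.blk q' (b k) ∩ Iio x : Set X) :=
    fun k => exists_large_Iio _ _ (hbk k)
  choose γ hγ hγ' using h2
  refine ⟨fun n => γ (Function.invFun b n), ?_⟩
  refine Sys.big_iff.mpr fun k => (hγ' k).trans (Cardinal.mk_le_mk_of_subset ?_)
  rintro x ⟨⟨hx1, hx2⟩, hx3⟩
  refine ⟨hq' hx1, ?_⟩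
  have hinv : Function.invFun b (b k) = k := Function.leftInverse_invFun hbm.injective k
  refine ⟨?_, ?_⟩
  · show x < γ (Function.invFun b (M.bl x))
    rw [hx2, hinv]; exact hx3
  · intro j hj hxj
    show γ (Function.invFun b (M.bl x)) < _
    rw [hx2, hinv]
    have hg := hγ k
    have e1 : χ x = ζ (b k) := by rw [hζ x hx1, hx2]
    have e2 : χ (γ k) = ζ (b k) := by rw [hζ _ hg.1, hg.2]
    rcases ho : ζ (b k) with _ | j0
    · exact absurd hxj (hχ x (e1.trans ho) j hj)
    · have h3 := (hχ' x j0 (e1.trans ho)).2 j hj hxj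
      have h4 := (hχ' (γ k) j0 (e2.trans ho)).1
      rw [hg.2] at h4
      rw [hx2] at h3
      exact h4.trans_le h3

variable (M) in
def Sys.good (q : Set X) (σ : W → Lab X) (i : W) : Prop :=
  M.Small (q \ M.C σ i (σ i)) ∧ ∀ ℓ, WellOrderingRel ℓ (σ i) → M.Small (q ∩ M.C σ i ℓ)

lemma Sys.good.mono {p q : Set X} {σ : W → Lab X} {i : W} (h : M.good p σ i) (hle : M.Le q p) :
    M.good q σ i := by
  refine ⟨(h.1.union hle).mono ?_, fun ℓ hℓ => ((h.2 ℓ hℓ).union hle).mono ?_⟩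
  · intro x hx
    by_cases hp : x ∈ p
    · left; exact ⟨hp, hx.2⟩
    · right; exact ⟨hx.1, hp⟩
  · intro x hx
    by_cases hp : x ∈ p
    · left; exact ⟨hp, hx.2⟩
    · right; exact ⟨hx.1, hp⟩

lemma Sys.good.congr {q : Set X} {σ τ : W → Lab X} {i : W} (h : M.good q σ i)
    (he : ∀ j ≤ i, σ j = τ j) : M.good q τ i := by
  unfold Sys.good at *
  rw [← Sys.C_congr (M := M) fun j (hj : j < i) => he j hj.le, ← he i le_rfl]
  exact h

variable (M) in
/-- a condition -/
structure Sys.Cond where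
  q : Set X
  σ : W → Lab X
  S : Set W
  big : M.Big q
  cnt : S.Countable
  low : IsLowerSet S
  dec : ∀ i ∈ S, M.good q σ i

def Sys.Cond.le (c' c : M.Cond) : Prop := M.Le c'.q c.q ∧ c.S ⊆ c'.S

lemma Sys.Cond.le.refl (c : M.Cond) : c.le c := ⟨Sys.Le.refl _, subset_refl _⟩
lemma Sys.Cond.le.trans {c d e : M.Cond} (h : e.le d) (h' : d.le c) : e.le c :=
  ⟨h.1.trans h'.1, h'.2.trans h.2⟩

/-- uniqueness -/
lemma Sys.dec_unique {r : Set X} (hr : M.Big r) {σ τ : W → Lab X} {S : Set W}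
    (hS : IsLowerSet S) (h1 : ∀ i ∈ S, M.good r σ i) (h2 : ∀ i ∈ S, M.good r τ i) :
    ∀ i ∈ S, σ i = τ i := by
  intro i
  induction i using WellFoundedLT.induction with
  | _ i ih =>
  intro hi
  have hC : M.C σ i = M.C τ i := Sys.C_congr fun j hj => ih j hj (hS hj.le hi)
  have aux : ∀ ℓ, M.Small (r \ M.C σ i ℓ) → ¬ M.Small (r ∩ M.C σ i ℓ) := by
    intro ℓ h h'
    refine Sys.not_big.mpr ((h.union h').mono ?_) hr
    intro x hx
    by_cases hc : x ∈ M.C σ i ℓ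
    · right; exact ⟨hx, hc⟩
    · left; exact ⟨hx, hc⟩
  rcases trichotomous_of (WellOrderingRel (α := Lab X)) (σ i) (τ i) with h | h | h
  · have := (h2 i hi).2 _ h
    rw [← hC] at this
    exact absurd this (aux _ (h1 i hi).1)
  · exact h
  · have := (h1 i hi).2 _ h
    have h3 := (h2 i hi).1
    rw [← hC] at h3
    exact absurd this (aux _ h3)

lemma Sys.Cond.agree (c d : M.Cond) (h : M.Big (c.q ∩ d.q)) {i : W} (hc : i ∈ c.S) (hd : i ∈ d.S) :
    c.σ i = d.σ i := by
  refine Sys.dec_unique h (c.low.inter d.low)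
    (fun j hj => (c.dec j hj.1).mono (Sys.Le.of_subset inter_subset_left))
    (fun j hj => (d.dec j hj.2).mono (Sys.Le.of_subset inter_subset_right)) i ⟨hc, hd⟩

lemma Sys.Cond.le.agree {c d : M.Cond} (h : d.le c) {i : W} (hc : i ∈ c.S) :
    d.σ i = c.σ i :=
  Sys.Cond.agree d c (d.big.inter_of_le h.1) (h.2 hc) hc

lemma Sys.Cond.le.C_eq {c d : M.Cond} (h : d.le c) {i : W} (hc : i ∈ c.S) :
    M.C d.σ i (d.σ i) = M.C c.σ i (c.σ i) := by
  rw [h.agree hc, Sys.C_congr fun j (hj : j < i) => h.agree (c.low hj.le hc)]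

/-- gluing countably many conditions below a given big set -/
lemma Sys.glue {ι : Type} [Countable ι] (c : ι → M.Cond) (q : Set X) (hq : M.Big q)
    (hle : ∀ k, M.Le q (c k).q) : ∃ d : M.Cond, d.q = q ∧ d.S = ⋃ k, (c k).S := by
  have hag : ∀ k l i, i ∈ (c k).S → i ∈ (c l).S → (c k).σ i = (c l).σ i := by
    intro k l i hk hl
    refine Sys.Cond.agree (c k) (c l) ?_ hk hl
    refine (hq.of_diff (Sys.Small.union (hle k) (hle l))).mono ?_
    intro x hx
    by_contra hc
    refine hx.2 ?_
    by_cases h1 : x ∈ (c k).q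
    · right; exact ⟨hx.1, fun h2 => hc ⟨h1, h2⟩⟩
    · left; exact ⟨hx.1, h1⟩
  by_cases hX : Nonempty X
  swap
  · obtain ⟨x, _⟩ := hq.nonempty; exact absurd ⟨x⟩ hX
  have hσ : ∀ i : W, ∃ ℓ : Lab X, ∀ k, i ∈ (c k).S → (c k).σ i = ℓ := by
    intro i
    by_cases h : ∃ k, i ∈ (c k).S
    · obtain ⟨k, hk⟩ := h
      exact ⟨(c k).σ i, fun l hl => hag l k i hl hk⟩
    · exact ⟨fun _ => hX.some, fun k hk => absurd ⟨k, hk⟩ h⟩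
  choose σ hσ using hσ
  refine ⟨⟨q, σ, ⋃ k, (c k).S, hq, countable_iUnion fun k => (c k).cnt,
    isLowerSet_iUnion fun k => (c k).low, ?_⟩, rfl, rfl⟩
  intro i hi
  obtain ⟨k, hk⟩ := mem_iUnion.mp hi
  exact (((c k).dec i hk).mono (hle k)).congr fun j hj => hσ j k ((c k).low hj hk)

/-- restricting a condition to a smaller big set -/
def Sys.Cond.restrict (c : M.Cond) (q : Set X) (hq : M.Big q) (hle : M.Le q c.q) : M.Cond :=
  ⟨q, c.σ, c.S, hq, c.cnt, c.low, fun i hi => (c.dec i hi).mono hle⟩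

lemma Sys.fuse (c : ℕ → M.Cond) (hle : ∀ k, (c (k+1)).le (c k)) :
    ∃ d : M.Cond, d.q ⊆ (c 0).q ∧ ∀ k, d.le (c k) := by
  obtain ⟨r, hr, hb, hrl⟩ := Sys.lower_bound (fun k => (c k).q) (fun k => (c k).big)
    (fun k => (hle k).1)
  obtain ⟨d, hd, hS⟩ := Sys.glue c r hb hrl
  refine ⟨d, hd ▸ hr, fun k => ⟨by rw [hd]; exact hrl k, ?_⟩⟩
  rw [hS]; exact subset_iUnion (fun k => (c k).S) k

/-- the minimal deciding label -/
lemma Sys.exists_min_label (σ : W → Lab X) (i : W) {q : Set X} (hq : M.Big q) :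
    ∃ ℓ, M.Big (q ∩ M.C σ i ℓ) ∧ ∀ ℓ', WellOrderingRel ℓ' ℓ → M.Small (q ∩ M.C σ i ℓ') := by
  let s : Set (Lab X) := {ℓ | M.Big (q ∩ M.C σ i ℓ)}
  have hs : s.Nonempty := Sys.C_progress σ i hq
  have wf : WellFounded (WellOrderingRel (α := Lab X)) := IsWellFounded.wf
  exact ⟨wf.min s hs, wf.min_mem s hs, fun ℓ' h => Sys.not_big.mp fun hb => wf.not_lt_min s hb h⟩

/-- extending by one -/
lemma Sys.Cond.step (c : M.Cond) (i : W) (hi : c.S = Iio i) (ℓ : Lab X) (q : Set X)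
    (hq : M.Big q) (hle : M.Le q c.q) (h1 : M.Small (q \ M.C c.σ i ℓ))
    (h2 : ∀ ℓ', WellOrderingRel ℓ' ℓ → M.Small (q ∩ M.C c.σ i ℓ')) :
    ∃ d : M.Cond, d.q = q ∧ d.S = Iic i ∧ d.σ i = ℓ ∧ ∀ j < i, d.σ j = c.σ j := by
  classical
  have hu : ∀ j < i, Function.update c.σ i ℓ j = c.σ j := fun j hj => by
    rw [Function.update_of_ne hj.ne]
  refine ⟨⟨q, Function.update c.σ i ℓ, Iic i, hq, W_countable_Iic i, isLowerSet_Iic i, ?_⟩,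
    rfl, rfl, by simp, hu⟩
  intro j hj
  rcases lt_or_eq_of_le (show j ≤ i from hj) with hj | rfl
  · refine ((c.dec j (by rw [hi]; exact hj)).mono hle).congr fun j' hj' => ?_
    exact (hu j' (hj'.trans_lt hj)).symm
  · unfold Sys.good
    rw [Sys.C_congr hu]
    simp only [Function.update_self]
    exact ⟨h1, h2⟩

lemma Sys.Cond.extend (b : W) (c : M.Cond) : ∃ d : M.Cond, d.q ⊆ c.q ∧ d.le c ∧ b ∈ d.S := by
  induction b using WellFoundedLT.induction generalizing c with
  | _ b ih =>
  by_cases hb : b ∈ c.S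
  · exact ⟨c, subset_refl _, Sys.Cond.le.refl c, hb⟩
  have hc : ∃ d : M.Cond, d.q ⊆ c.q ∧ d.le c ∧ Iio b ⊆ d.S := by
    rcases (Iio b).eq_empty_or_nonempty with he | hne
    · exact ⟨c, subset_refl _, Sys.Cond.le.refl c, by rw [he]; exact empty_subset _⟩
    obtain ⟨e, he⟩ := (W_countable_Iio b).exists_eq_range hne
    have he' : ∀ k, e k < b := fun k => by
      have : e k ∈ Iio b := by rw [he]; exact mem_range_self k
      exact this
    choose f hf1 hf2 hf3 using fun k c => ih (e k) (he' k) c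
    let s : ℕ → M.Cond := fun k => Nat.rec c (fun k v => f k v) k
    obtain ⟨d, hd1, hd2⟩ := Sys.fuse s (fun k => hf2 k (s k))
    refine ⟨d, hd1, hd2 0, ?_⟩
    rw [he]; rintro _ ⟨k, rfl⟩
    exact (hd2 (k+1)).2 (hf3 k (s k))
  obtain ⟨d, hd1, hd2, hd3⟩ := hc
  by_cases hbd : b ∈ d.S
  · exact ⟨d, hd1, hd2, hbd⟩
  have hS : d.S = Iio b := by
    refine subset_antisymm ?_ hd3
    intro x hx
    by_contra hc
    exact hbd (d.low (not_lt.mp hc) hx)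
  obtain ⟨ℓ, hl1, hl2⟩ := Sys.exists_min_label d.σ b d.big
  obtain ⟨e, he1, he2, he3, he4⟩ := d.step b hS ℓ (d.q ∩ M.C d.σ b ℓ) hl1
    (Sys.Le.of_subset inter_subset_left)
    (Sys.small_empty.mono (by intro x hx; exact hx.2 hx.1.2))
    (fun ℓ' h => (hl2 ℓ' h).mono (by intro x hx; exact ⟨hx.1.1, hx.2⟩))
  have hed : e.q ⊆ d.q := by rw [he1]; exact inter_subset_left
  refine ⟨e, hed.trans hd1, Sys.Cond.le.trans (d := d) ⟨Sys.Le.of_subset hed, ?_⟩ hd2, ?_⟩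
  · rw [hS, he2]; exact Iio_subset_Iic_self
  · rw [he2]; exact mem_Iic.mpr le_rfl

/-- extending to contain a countable set -/
lemma Sys.Cond.extend' (c : M.Cond) {A : Set W} (hA : A.Countable) :
    ∃ d : M.Cond, d.q ⊆ c.q ∧ d.le c ∧ A ⊆ d.S := by
  obtain ⟨b, hb⟩ := W_bound hA
  obtain ⟨d, h1, h2, h3⟩ := c.extend b
  exact ⟨d, h1, h2, fun x hx => d.low (hb x hx).le h3⟩

/-- trivial condition -/
def Sys.triv (p : Set X) (hp : M.Big p) : M.Cond :=
  ⟨p, fun _ _ => hp.nonempty.some, ∅, hp, countable_empty, isLowerSet_empty, by simp⟩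

end BN
namespace BN
set_option linter.unusedSectionVars false
set_option linter.deprecated false

abbrev Om2 : Type := (ℵ_ 2).ord.ToType
lemma mk_Om2 : #Om2 = ℵ_ 2 := Cardinal.mk_ord_toType _

/-- the combinatorial core -/
def Core {X : Type} (M : Sys X) : Prop :=
  ∃ p0 : Set X, M.Big p0 ∧ ∃ K : Type, #K ≤ ℵ_ 1 ∧ ∃ E : Om2 → K → Set (Set X),
    (∀ ε ε' k q q', q ∈ E ε k → q' ∈ E ε' k → M.Big (q ∩ q') → ε = ε') ∧
    ∀ ε p, M.Big p → p ⊆ p0 → ∃ k, ∃ q ∈ E ε k, M.Big q ∧ q ⊆ p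

lemma exists_enum : ∃ e : W → W → ℕ, ∀ a, InjOn (e a) (Iio a) := by
  have : ∀ a : W, ∃ e : W → ℕ, InjOn e (Iio a) := fun a =>
    (Set.countable_iff_exists_injOn).mp (W_countable_Iio a)
  choose e he using this
  exact ⟨e, he⟩

def enm : W → W → ℕ := exists_enum.choose
lemma enm_inj (a : W) : InjOn (enm a) (Iio a) := exists_enum.choose_spec a

abbrev G : Type := ℕ → Finset ℕ

variable {X : Type} [LinearOrder X] [WellFoundedLT X] {M : Sys X}

lemma Sys.tr_finite (σ : W → Lab X) (a : W) (x : X) :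
    {n | ∃ j < a, x ∈ M.C σ j (σ j) ∧ n = enm a j}.Finite := by
  refine ((Sys.C_finite (M := M) σ x).image (enm a)).subset ?_
  rintro n ⟨j, _, hj, rfl⟩
  exact ⟨j, hj, rfl⟩

variable (M) in
def Sys.tr (σ : W → Lab X) (a : W) (x : X) : Finset ℕ := (Sys.tr_finite (M := M) σ a x).toFinset

lemma Sys.mem_tr {σ : W → Lab X} {a j : W} (hj : j < a) {x : X} :
    enm a j ∈ M.tr σ a x ↔ x ∈ M.C σ j (σ j) := by
  simp only [Sys.tr, Set.Finite.mem_toFinset, mem_ofPred_eq]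
  constructor
  · rintro ⟨j', hj', h, he⟩
    rw [enm_inj a hj hj' he]; exact h
  · intro h; exact ⟨j, hj, h, rfl⟩

lemma Sys.tr_congr {σ τ : W → Lab X} {a : W} (h : ∀ j < a, σ j = τ j) : M.tr σ a = M.tr τ a := by
  funext x
  unfold Sys.tr
  congr 1
  ext n
  simp only [mem_ofPred_eq]
  refine exists_congr fun j => and_congr_right fun hj => ?_
  rw [Sys.C_congr fun j' (hj' : j' < j) => h j' (hj'.trans hj), h j hj]

variable (M) in
def Sys.tdec (q : Set X) (σ : W → Lab X) (a : W) (g : G) : Prop :=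
  M.Small (q \ {x | M.tr σ a x = g (M.bl x)}) ∧
    ∀ g', WellOrderingRel g' g → M.Small (q ∩ {x | M.tr σ a x = g' (M.bl x)})

lemma Sys.tdec.mono {p q : Set X} {σ : W → Lab X} {i : W} {g : G} (h : M.tdec p σ i g)
    (hle : M.Le q p) : M.tdec q σ i g := by
  refine ⟨(h.1.union hle).mono ?_, fun ℓ hℓ => ((h.2 ℓ hℓ).union hle).mono ?_⟩
  · intro x hx
    by_cases hp : x ∈ p
    · left; exact ⟨hp, hx.2⟩
    · right; exact ⟨hx.1, hp⟩
  · intro x hx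
    by_cases hp : x ∈ p
    · left; exact ⟨hp, hx.2⟩
    · right; exact ⟨hx.1, hp⟩

lemma Sys.tdec.congr {q : Set X} {σ τ : W → Lab X} {a : W} {g : G} (h : M.tdec q σ a g)
    (he : ∀ j < a, σ j = τ j) : M.tdec q τ a g := by
  unfold Sys.tdec at *
  rwa [← Sys.tr_congr he]

lemma Sys.tdec_unique {r : Set X} (hr : M.Big r) {σ : W → Lab X} {a : W} {g g' : G}
    (h1 : M.tdec r σ a g) (h2 : M.tdec r σ a g') : g = g' := by
  have aux : ∀ s : Set X, M.Small (r \ s) → ¬ M.Small (r ∩ s) := by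
    intro s h h'
    refine Sys.not_big.mpr ((h.union h').mono ?_) hr
    intro x hx
    by_cases hc : x ∈ s
    · right; exact ⟨hx, hc⟩
    · left; exact ⟨hx, hc⟩
  rcases trichotomous_of (WellOrderingRel (α := G)) g g' with h | h | h
  · exact absurd (h2.2 _ h) (aux _ h1.1)
  · exact h
  · exact absurd (h1.2 _ h) (aux _ h2.1)

lemma Sys.tdec_dense {q : Set X} (hq : M.Big q) (σ : W → Lab X) (a : W) :
    ∃ q' ⊆ q, M.Big q' ∧ ∃ g, M.tdec q' σ a g := by
  have hZ : #(Finset ℕ) < M.μ :=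
    (Cardinal.mk_le_aleph0).trans_lt (aleph0_lt_aleph_one'.trans Sys.aleph1_lt)
  let s : Set G := {g | M.Big (q ∩ {x | M.tr σ a x = g (M.bl x)})}
  have hs : s.Nonempty := by
    obtain ⟨q', hq', hb, ζ, hζ⟩ := hq.homog (M.tr σ a) hZ
    exact ⟨ζ, hb.mono fun x hx => ⟨hq' hx, hζ x hx⟩⟩
  have wf : WellFounded (WellOrderingRel (α := G)) := IsWellFounded.wf
  refine ⟨q ∩ {x | M.tr σ a x = wf.min s hs (M.bl x)}, inter_subset_left, wf.min_mem s hs,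
    wf.min s hs, Sys.small_empty.mono (by intro x hx; exact hx.2 hx.1.2), fun g' h => ?_⟩
  have := Sys.not_big.mp fun hb => wf.not_lt_min s (x := g') hb h
  exact this.mono (by intro x hx; exact ⟨hx.1.1, hx.2⟩)

variable (M) in
structure Sys.TCond where
  c : M.Cond
  t : W → G
  ht : ∀ i ∈ c.S, M.tdec c.q c.σ i (t i)

lemma Sys.TCond.agree (T U : M.TCond) (h : M.Big (T.c.q ∩ U.c.q)) {i : W} (hT : i ∈ T.c.S)
    (hU : i ∈ U.c.S) : T.t i = U.t i := by
  have h1 := (T.ht i hT).mono (Sys.Le.of_subset (M := M)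
    (inter_subset_left : T.c.q ∩ U.c.q ⊆ T.c.q))
  have h2 := (U.ht i hU).mono (Sys.Le.of_subset (M := M)
    (inter_subset_right : T.c.q ∩ U.c.q ⊆ U.c.q))
  refine Sys.tdec_unique h h1 (h2.congr fun j hj => ?_)
  exact (Sys.Cond.agree _ _ h (T.c.low hj.le hT) (U.c.low hj.le hU)).symm

lemma Sys.TCond.agree' (T U : M.TCond) (h : T.c.le U.c) {i : W} (hU : i ∈ U.c.S) :
    T.t i = U.t i :=
  Sys.TCond.agree T U (T.c.big.inter_of_le h.1) (h.2 hU) hU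

lemma Sys.Cond.toT (c : M.Cond) : ∃ T : M.TCond, T.c.q ⊆ c.q ∧ T.c.le c := by
  rcases c.S.eq_empty_or_nonempty with he | hne
  · exact ⟨⟨c, fun _ _ => ∅, by rw [he]; simp⟩, subset_refl _, Sys.Cond.le.refl c⟩
  obtain ⟨e, he⟩ := c.cnt.exists_eq_range hne
  have h1 : ∀ k (q : {q // M.Big q}), ∃ q' : {q // M.Big q}, q'.1 ⊆ q.1 ∧
      ∃ g, M.tdec q'.1 c.σ (e k) g := by
    rintro k ⟨q, hq⟩
    obtain ⟨q', h1, h2, h3⟩ := Sys.tdec_dense hq c.σ (e k)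
    exact ⟨⟨q', h2⟩, h1, h3⟩
  choose f hf hf' using h1
  let s : ℕ → {q // M.Big q} := fun k => Nat.rec ⟨c.q, c.big⟩ (fun k v => f k v) k
  obtain ⟨r, hr, hb, hrl⟩ := Sys.lower_bound (fun k => (s k).1) (fun k => (s k).2)
    (fun k => Sys.Le.of_subset (hf k (s k)))
  have h2 : ∀ i, ∃ g, i ∈ c.S → M.tdec r c.σ i g := by
    intro i
    by_cases hi : i ∈ c.S
    · rw [he] at hi
      obtain ⟨k, rfl⟩ := hi
      obtain ⟨g, hg⟩ := hf' k (s k)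
      exact ⟨g, fun _ => hg.mono (hrl (k+1))⟩
    · exact ⟨fun _ => ∅, fun h => absurd h hi⟩
  choose t ht using h2
  have hle : M.Le r c.q := hrl 0
  exact ⟨⟨c.restrict r hb hle, t, fun i hi => ht i hi⟩, hr, hle, subset_refl _⟩

/-- key splitting claim -/
lemma Sys.claimS (p : Set X) (hp : M.Big p) : ∃ c : M.Cond, c.q ⊆ p ∧ ∃ i ∈ c.S,
    c.q ⊆ M.C c.σ i (c.σ i) ∧
    ∀ N, {n | (M.blk c.q n).Nonempty ∧ #(M.blk (p \ M.C c.σ i (c.σ i)) n) ≤ M.m N}.Finite := by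
  classical
  by_contra! hfail
  let Q : Type := {c : M.Cond // ∃ A : Set ℕ, c.q = p ∩ {x | M.bl x ∈ A}}
  let R : Q → Q → Prop := fun v u => v.1.le u.1
  let Iz : Q → ℕ × ℕ → Set W := fun u z => {i | i ∈ u.1.S ∧
    #(M.blk (p \ M.C u.1.σ i (u.1.σ i)) z.1) ≤ M.m z.2 ∧ M.m z.2 < #(M.blk p z.1)}
  have hfin : ∀ u z, (Iz u z).Finite := by
    intro u z
    by_contra hinf
    have hinf : (Iz u z).Infinite := hinf
    obtain ⟨I, hI, hIinf, hIc⟩ : ∃ I ⊆ Iz u z, I.Infinite ∧ I.Countable := by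
      have := hinf.to_subtype
      refine ⟨range fun k => (Infinite.natEmbedding (Iz u z) k : W), ?_, ?_, countable_range _⟩
      · rintro _ ⟨k, rfl⟩; exact Subtype.coe_prop _
      · exact infinite_range_of_injective
          (Subtype.coe_injective.comp (Infinite.natEmbedding (Iz u z)).injective)
    have hcI : Countable I := hIc.to_subtype
    have h1 : #(⋃ i : I, M.blk (p \ M.C u.1.σ i (u.1.σ i)) z.1 : Set X) ≤ M.m z.2 :=
      Sys.small_of_countable_iUnion _ _ fun i => (hI i.2).2.1
    obtain ⟨i0, hi0⟩ := hIinf.nonempty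
    have h2 : M.m z.2 < #(M.blk p z.1) := (hI hi0).2.2
    have h3 : ∃ x ∈ M.blk p z.1, x ∉ (⋃ i : I, M.blk (p \ M.C u.1.σ i (u.1.σ i)) z.1 : Set X) := by
      by_contra! hc
      exact absurd (h2.trans_le ((Cardinal.mk_le_mk_of_subset hc).trans h1)) (lt_irrefl _)
    obtain ⟨x, hx, hx'⟩ := h3
    refine hIinf ((Sys.C_finite (M := M) u.1.σ x).subset fun i hi => ?_)
    by_contra hc
    exact hx' (mem_iUnion.mpr ⟨⟨i, hi⟩, ⟨hx.1, hc⟩, hx.2⟩)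
  have hmono : ∀ u v z, R v u → Iz u z ⊆ Iz v z := by
    intro u v z h i hi
    refine ⟨h.2 hi.1, ?_⟩
    rw [Sys.Cond.le.C_eq h hi.1]
    exact hi.2
  let N : Q → ℕ × ℕ → ℕ := fun u z => (Iz u z).ncard
  have hσ : ∀ u : ℕ → Q, (∀ k, R (u (k+1)) (u k)) → ∃ v, ∀ k, R v (u k) := by
    intro u hu
    obtain ⟨d, hd1, hd2⟩ := Sys.fuse (fun k => (u k).1) hu
    choose A hA using fun k => (u k).2
    have hbig : ∀ k, M.Big (p ∩ {x | ∀ j ≤ k, M.bl x ∈ A j}) := by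
      intro k
      have h1 : M.Small (⋃ j ∈ Iic k, (d.q \ (u j).1.q)) :=
        Sys.small_finite_iUnion (finite_Iic k) _ (fun j _ => (hd2 j).1)
      refine (Sys.Big.of_diff d.big h1).mono ?_
      intro x hx
      have : ∀ j ≤ k, x ∈ (u j).1.q := by
        intro j hj
        by_contra hc
        exact hx.2 (by simp only [mem_iUnion]; exact ⟨j, hj, hx.1, hc⟩)
      refine ⟨?_, ?_⟩
      · have := this 0 (Nat.zero_le _); rw [hA] at this; exact this.1
      · intro j hj; have := this j hj; rw [hA] at this; exact this.2
    choose b hb1 hb2 using fun k => (hbig k).blocks k k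
    have hbA : ∀ k j, j ≤ k → b k ∈ A j := by
      intro k j hj
      have : 0 < #(M.blk (p ∩ {x | ∀ j ≤ k, M.bl x ∈ A j}) (b k)) := bot_lt_of_lt (hb2 k)
      obtain ⟨x, hx⟩ := Cardinal.mk_ne_zero_iff.mp this.ne'
      rw [← hx.2]; exact hx.1.2 j hj
    let q := p ∩ {x | M.bl x ∈ range b}
    have hq : M.Big q := Sys.big_of_blocks b fun k => (hb2 k).le.trans
      (Cardinal.mk_le_mk_of_subset fun x hx => ⟨⟨hx.1.1, k, hx.2.symm⟩, hx.2⟩)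
    have hle : ∀ k, M.Le q (u k).1.q := by
      intro k
      have h1 : M.Small {x | M.bl x ∈ b '' Iio k} := Sys.small_blocks ((finite_Iio k).image b)
      refine h1.mono ?_
      rintro x ⟨⟨hx1, j, hj⟩, hx2⟩
      refine ⟨j, ?_, hj⟩
      by_contra hc
      refine hx2 ?_
      rw [hA]
      refine ⟨hx1, ?_⟩
      show M.bl x ∈ A k
      rw [← hj]
      exact hbA j k (not_lt.mp hc)
    obtain ⟨e, he1, he2⟩ := Sys.glue (fun k => (u k).1) q hq hle
    refine ⟨⟨e, range b, he1⟩, fun k => ⟨?_, ?_⟩⟩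
    · show M.Le e.q _
      rw [he1]; exact hle k
    · show _ ⊆ e.S
      rw [he2]; exact subset_iUnion (fun k => (u k).1.S) k
  have u0 : Q := ⟨Sys.triv p hp, Set.univ, by simp [Sys.triv]⟩
  obtain ⟨u, hu⟩ := no_mono R (fun u v w h h' => Sys.Cond.le.trans h h')
    (fun u => Sys.Cond.le.refl _) hσ N
    (fun u v z h => Set.ncard_le_ncard (hmono u v z h) (hfin v z)) u0
  -- now extend
  obtain ⟨c, A, hA⟩ := u
  obtain ⟨i, hi⟩ := W_lower c.cnt c.low
  obtain ⟨ℓ, hl1, hl2⟩ := Sys.exists_min_label c.σ i c.big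
  obtain ⟨b, hb, hbk⟩ := hl1.seq id
  let q := (c.q ∩ M.C c.σ i ℓ) ∩ {x | M.bl x ∈ range b}
  have hqblk : ∀ k, M.blk (c.q ∩ M.C c.σ i ℓ) (b k) ⊆ M.blk q (b k) :=
    fun k x hx => ⟨⟨hx.1, k, hx.2.symm⟩, hx.2⟩
  have hq : M.Big q := Sys.big_of_blocks b fun k => (hbk k).le.trans
    (Cardinal.mk_le_mk_of_subset (hqblk k))
  have hqc : q ⊆ c.q := fun x hx => hx.1.1
  have hcp : c.q ⊆ p := by rw [hA]; exact inter_subset_left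
  obtain ⟨d, hd1, hd2, hd3, hd4⟩ := c.step i hi ℓ q hq (Sys.Le.of_subset hqc)
    (Sys.small_empty.mono (by intro x hx; exact hx.2 hx.1.1.2))
    (fun ℓ' h => (hl2 ℓ' h).mono (by intro x hx; exact ⟨hx.1.1.1, hx.2⟩))
  have hC : M.C d.σ i (d.σ i) = M.C c.σ i ℓ := by rw [hd3, Sys.C_congr hd4]
  obtain ⟨N0, hN0⟩ := hfail d (by rw [hd1]; exact hqc.trans hcp) i (by rw [hd2]; exact le_refl i)
    (by rw [hd1, hC]; intro x hx; exact hx.1.2)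
  rw [hd1, hC] at hN0
  let Bs := {n | (M.blk q n).Nonempty ∧ #(M.blk (p \ M.C c.σ i ℓ) n) ≤ M.m N0}
  have hN0 : Bs.Infinite := hN0
  let r := p ∩ {x | M.bl x ∈ Bs}
  have hBr : ∀ n ∈ Bs, ∃ k, n = b k ∧ M.blk (c.q ∩ M.C c.σ i ℓ) (b k) ⊆ M.blk r n := by
    rintro n hn
    obtain ⟨x, ⟨hx1, k, hx2⟩, hx3⟩ := hn.1
    have hk : n = b k := by rw [hx2, hx3]
    refine ⟨k, hk, ?_⟩
    rintro y ⟨hy1, hy2⟩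
    refine ⟨⟨hcp hy1.1, ?_⟩, by rw [hk, hy2]⟩
    show M.bl y ∈ Bs
    rw [hy2, ← hk]; exact hn
  have hr : M.Big r := by
    refine Sys.big_of_blocks' fun k => ?_
    obtain ⟨n, hn, hnk⟩ := hN0.exists_gt (b k)
    obtain ⟨k', hk', hsub⟩ := hBr n hn
    refine ⟨n, (M.hmono ?_).trans ((hbk k').le.trans (Cardinal.mk_le_mk_of_subset hsub))⟩
    rw [hk'] at hnk
    exact (hb.lt_iff_lt.mp hnk).le
  have hrc : r ⊆ c.q := by
    rintro x ⟨hx1, hx2⟩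
    obtain ⟨y, hy1, hy2⟩ := hx2.1
    have h3 := hqc hy1
    rw [hA] at h3 ⊢
    refine ⟨hx1, ?_⟩
    show M.bl x ∈ A
    rw [← hy2]; exact h3.2
  have hsm : M.Small (r \ M.C c.σ i ℓ) := by
    have h1 : #(⋃ n : Bs, M.blk (p \ M.C c.σ i ℓ) n : Set X) ≤ M.m N0 :=
      Sys.small_of_countable_iUnion _ _ fun n => n.2.2
    refine Sys.Small.mono (h1.trans_lt (M.hlt N0)) ?_
    rintro x ⟨⟨hx1, hx2⟩, hx3⟩
    exact mem_iUnion.mpr ⟨⟨_, hx2⟩, ⟨hx1, hx3⟩, rfl⟩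
  obtain ⟨e, he1, he2, he3, he4⟩ := c.step i hi ℓ r hr (Sys.Le.of_subset hrc) hsm
    (fun ℓ' h => (hl2 ℓ' h).mono (by intro x hx; exact ⟨hrc hx.1, hx.2⟩))
  have hCe : M.C e.σ i (e.σ i) = M.C c.σ i ℓ := by rw [he3, Sys.C_congr he4]
  have hle : e.le c := ⟨by rw [he1]; exact Sys.Le.of_subset hrc, by
    rw [hi, he2]; exact Iio_subset_Iic_self⟩
  obtain ⟨n, -, hn⟩ := hr.blocks N0 0
  have hnB : n ∈ Bs := by
    have : 0 < #(M.blk r n) := bot_lt_of_lt hn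
    obtain ⟨x, hx⟩ := Cardinal.mk_ne_zero_iff.mp this.ne'
    rw [← hx.2]; exact hx.1.2
  have hv := hu ⟨e, Bs, he1⟩ hle (n, N0)
  have hlt : (Iz ⟨c, A, hA⟩ (n, N0)).ncard < (Iz ⟨e, Bs, he1⟩ (n, N0)).ncard := by
    refine Set.ncard_lt_ncard ⟨hmono _ _ _ hle, fun hsub => ?_⟩ (hfin _ _)
    have : i ∈ Iz ⟨e, Bs, he1⟩ (n, N0) := by
      refine ⟨by rw [he2]; exact le_refl i, ?_, ?_⟩
      · show #(M.blk (p \ M.C e.σ i (e.σ i)) n) ≤ M.m N0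
        rw [hCe]; exact hnB.2
      · exact hn.trans_le (Cardinal.mk_le_mk_of_subset fun x hx => ⟨hx.1.1, hx.2⟩)
    have h2 := (hsub this).1
    rw [hi] at h2
    exact lt_irrefl i (mem_Iio.mp h2)
  exact hlt.ne' hv

end BN
namespace BN
set_option linter.unusedSectionVars false
set_option linter.deprecated false

variable {X : Type} [LinearOrder X] [WellFoundedLT X] {M : Sys X}

lemma Sys.split (p : Set X) (hp : M.Big p) : ∃ T U : M.TCond, T.c.q ⊆ p ∧ U.c.q ⊆ p ∧
    ∃ i, i ∈ T.c.S ∧ i ∈ U.c.S ∧ T.t i ≠ U.t i := by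
  choose f hf1 fi hf2 hf3 hf4 using fun p : {p // M.Big p} => Sys.claimS p.1 p.2
  let q : ℕ → {p // M.Big p} := fun k => Nat.rec ⟨p, hp⟩ (fun _ v => ⟨(f v).q, (f v).big⟩) k
  let c : ℕ → M.Cond := fun k => f (q k)
  let i : ℕ → W := fun k => fi (q k)
  let Ck : ℕ → Set X := fun k => M.C (c k).σ (i k) ((c k).σ (i k))
  have hqs : ∀ k, (q (k+1)).1 = (c k).q := fun k => rfl
  have hsub : ∀ k, (q (k+1)).1 ⊆ (q k).1 := fun k => hf1 (q k)
  have hanti : Antitone fun k => (q k).1 := antitone_nat_of_succ_le hsub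
  have hqC : ∀ k, (q (k+1)).1 ⊆ Ck k := fun k => hf3 (q k)
  let D : ℕ → Set X := fun k => (q k).1 \ Ck k
  have hfin : ∀ k N, {n | (M.blk (q (k+1)).1 n).Nonempty ∧ #(M.blk (D k) n) ≤ M.m N}.Finite :=
    fun k N => hf4 (q k) N
  have hstep : ∀ m N, ∃ n ≥ N, ∀ k ≤ m, M.m m < #(M.blk (D k) n) := by
    intro m N
    have h1 : (⋃ k ∈ Iic m, {n | (M.blk (q (k+1)).1 n).Nonempty ∧
        #(M.blk (D k) n) ≤ M.m m}).Finite := (finite_Iic m).biUnion fun k _ => hfin k m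
    obtain ⟨B, hB⟩ := h1.bddAbove
    obtain ⟨n, hn, hn'⟩ := (q (m+1)).2.blocks 0 (max N (B+1))
    refine ⟨n, le_trans (le_max_left _ _) hn, fun k hk => ?_⟩
    by_contra hc
    have hne : (M.blk (q (k+1)).1 n).Nonempty := by
      have : 0 < #(M.blk (q (m+1)).1 n) := bot_lt_of_lt hn'
      obtain ⟨x, hx⟩ := Cardinal.mk_ne_zero_iff.mp this.ne'
      exact ⟨x, hanti (Nat.succ_le_succ hk) hx.1, hx.2⟩
    have h2 : n ≤ B := hB (by
      simp only [mem_iUnion]; exact ⟨k, hk, hne, not_lt.mp hc⟩)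
    have h3 : B + 1 ≤ n := le_trans (le_max_right _ _) hn
    omega
  choose g hg1 hg2 using hstep
  let a : ℕ → ℕ := fun k => Nat.rec (g 0 0) (fun k v => g (k+1) (v+1)) k
  have ha : StrictMono a := strictMono_nat_of_lt_succ fun k => hg1 (k+1) (a k + 1)
  have haD : ∀ m k, k ≤ m → M.m m < #(M.blk (D k) (a m)) := by
    intro m k hk
    cases m with
    | zero => exact hg2 0 0 k hk
    | succ m => exact hg2 (m+1) (a m + 1) k hk
  obtain ⟨α, hα⟩ := W_bound (countable_range i)
  have hα : ∀ k, i k < α := fun k => hα _ (mem_range_self k)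
  have main : ∀ (φ : ℕ → ℕ) (S : Set ℕ), S.Infinite → (∀ m, φ m ≤ m) → (∀ m k, 2 * k ≤ m → k ≤ φ m) →
      ∃ T : M.TCond, T.c.q ⊆ {x | ∃ m ∈ S, M.bl x = a m ∧ x ∈ D (φ m)} ∧ α ∈ T.c.S ∧
        ∀ k x, enm α (i k) ∈ M.tr T.c.σ α x ↔ x ∈ Ck k := by
    intro φ S hS hφ1 hφ2
    let r : Set X := {x | ∃ m ∈ S, M.bl x = a m ∧ x ∈ D (φ m)}
    have hr : M.Big r := by
      refine Sys.big_of_blocks' fun k => ?_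
      obtain ⟨m, hm, hmk⟩ := hS.exists_gt k
      refine ⟨a m, (M.hmono hmk.le).trans ((haD m (φ m) (hφ1 m)).le.trans
        (Cardinal.mk_le_mk_of_subset ?_))⟩
      intro x hx
      exact ⟨⟨m, hm, hx.2, hx.1⟩, hx.2⟩
    have hle : ∀ k, M.Le r (q k).1 := by
      intro k
      have h1 : M.Small {x | M.bl x ∈ a '' Iio (2 * k)} :=
        Sys.small_blocks ((finite_Iio (2 * k)).image a)
      refine h1.mono ?_
      rintro x ⟨⟨m, hm, hx1, hx2⟩, hx3⟩
      refine ⟨m, ?_, hx1.symm⟩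
      by_contra hc
      exact hx3 (hanti (hφ2 m k (not_lt.mp hc)) hx2.1)
    obtain ⟨d, hd1, hd2⟩ := Sys.glue c r hr (fun k => hle (k+1))
    obtain ⟨e, he1, he2, he3⟩ := d.extend α
    obtain ⟨T, hT1, hT2⟩ := e.toT
    have hTr : T.c.q ⊆ r := by rw [← hd1]; exact hT1.trans he1
    refine ⟨T, hTr, hT2.2 he3, fun k x => ?_⟩
    rw [Sys.mem_tr (hα k)]
    have hTc : T.c.le (c k) := by
      refine ⟨(Sys.Le.of_subset hTr).trans (hle (k+1)), ?_⟩
      refine (subset_iUnion (fun k => (c k).S) k).trans ?_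
      rw [← hd2]
      exact he2.2.trans hT2.2
    rw [hTc.C_eq (hf2 (q k))]
  obtain ⟨T, hT1, hT2, hT3⟩ := main (fun m => m / 2) Set.univ infinite_univ
    (fun m => Nat.div_le_self m 2) (fun m k h => by omega)
  let S : Set ℕ := {m | 1 ≤ m ∧ ∃ x ∈ T.c.q, M.bl x = a m ∧ M.tr T.c.σ α x = T.t α (M.bl x)}
  have hS : S.Infinite := by
    intro hfinS
    have h1 := (T.ht α hT2).1
    have h2 : M.Small {x | M.bl x ∈ a '' (S ∪ {0})} :=
      Sys.small_blocks ((hfinS.union (finite_singleton 0)).image a)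
    refine Sys.not_big.mpr ((h1.union h2).mono ?_) T.c.big
    intro x hx
    by_cases h : M.tr T.c.σ α x = T.t α (M.bl x)
    · right
      obtain ⟨m, -, hm, -⟩ := hT1 hx
      refine ⟨m, ?_, hm.symm⟩
      rcases Nat.eq_zero_or_pos m with h0 | h0
      · right; exact h0
      · left; exact ⟨h0, x, hx, hm, h⟩
    · left; exact ⟨hx, h⟩
  obtain ⟨U, hU1, hU2, hU3⟩ := main id S hS (fun m => le_refl m) (fun m k h => by simp; omega)
  have hD : ∀ k, D k ⊆ p := fun k x hx => hanti (Nat.zero_le k) hx.1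
  refine ⟨T, U, ?_, ?_, α, hT2, hU2, ?_⟩
  · intro x hx; obtain ⟨m, _, _, h⟩ := hT1 hx; exact hD _ h
  · intro x hx; obtain ⟨m, _, _, h⟩ := hU1 hx; exact hD _ h
  intro heq
  have hb : M.Big (U.c.q ∩ {x | M.tr U.c.σ α x = U.t α (M.bl x)}) :=
    U.c.big.inter_of_le (U.ht α hU2).1
  obtain ⟨x, hx1, hx2⟩ := hb.nonempty
  obtain ⟨m, ⟨hm1, y, hy1, hy2, hy3⟩, hxm, hxD⟩ := hU1 hx1
  have h1 : enm α (i (m/2)) ∈ M.tr U.c.σ α x := by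
    rw [hU3]
    exact hqC (m/2) (hanti (by omega : m/2+1 ≤ m) hxD.1)
  have h2 : enm α (i (m/2)) ∉ M.tr T.c.σ α y := by
    rw [hT3]
    obtain ⟨m', _, hm', hD'⟩ := hT1 hy1
    have : m' = m := ha.injective (by rw [← hm', hy2])
    subst this
    exact hD'.2
  have hx2 : M.tr U.c.σ α x = U.t α (M.bl x) := hx2
  rw [hx2, hxm, ← heq, ← hy2, ← hy3] at h1
  exact h2 h1

lemma Sys.TCond.split (T : M.TCond) {A : Set W} (hA : A.Countable) :
    ∃ U : Bool → M.TCond, (∀ b, (U b).c.q ⊆ T.c.q ∧ (U b).c.le T.c ∧ A ⊆ (U b).c.S) ∧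
      ∃ i, (∀ b, i ∈ (U b).c.S) ∧ (U true).t i ≠ (U false).t i := by
  obtain ⟨T1, T2, h1, h2, i, hi1, hi2, hne⟩ := Sys.split T.c.q T.c.big
  have ext : ∀ U : M.TCond, U.c.q ⊆ T.c.q → ∃ V : M.TCond, V.c.q ⊆ T.c.q ∧ V.c.le T.c ∧
      A ⊆ V.c.S ∧ V.c.le U.c := by
    intro U hU
    obtain ⟨d, hd1, hd2, hd3⟩ := U.c.extend' (hA.union T.c.cnt)
    obtain ⟨V, hV1, hV2⟩ := d.toT
    have hV : V.c.q ⊆ T.c.q := (hV1.trans hd1).trans hU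
    refine ⟨V, hV, ⟨Sys.Le.of_subset hV, ?_⟩, ?_, hV2.trans hd2⟩
    · exact (subset_union_right.trans hd3).trans hV2.2
    · exact (subset_union_left.trans hd3).trans hV2.2
  obtain ⟨V1, a1, b1, c1, d1⟩ := ext T1 h1
  obtain ⟨V2, a2, b2, c2, d2⟩ := ext T2 h2
  refine ⟨fun b => if b then V1 else V2, ?_, i, ?_, ?_⟩
  · rintro (_ | _)
    · exact ⟨a2, b2, c2⟩
    · exact ⟨a1, b1, c1⟩
  · rintro (_ | _)
    · exact d2.2 hi2
    · exact d1.2 hi1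
  · simp only [if_true, Bool.false_eq_true, if_false]
    rw [V1.agree' T1 d1 hi1, V2.agree' T2 d2 hi2]
    exact hne

/-- beginning of an infinite sequence, newest entry first -/
def pre {A : Type} (y : ℕ → A) : ℕ → List A
  | 0 => []
  | n+1 => y n :: pre y n

lemma pre_length {A : Type} (y : ℕ → A) (n : ℕ) : (pre y n).length = n := by
  induction n with
  | zero => rfl
  | succ n ih => simp [pre, ih]

lemma pre_congr {A : Type} {y z : ℕ → A} {n : ℕ} (h : ∀ k < n, y k = z k) : pre y n = pre z n := by
  induction n with
  | zero => rfl
  | succ n ih => simp [pre, ih (fun k hk => h k (hk.trans (Nat.lt_succ_self n))), h n (Nat.lt_succ_self n)]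

/-- the scheme lemma: below any big set there is a perfect tree of decisions -/
lemma Sys.scheme (p : Set X) (hp : M.Big p) : ∃ (a : W) (N : Iio a → ℕ) (h : Iio a → List Bool → G),
    (∀ b b' : ℕ → Bool, (∀ i, h i (pre b (N i)) = h i (pre b' (N i))) → b = b') ∧
    ∀ b : ℕ → Bool, ∃ c : M.Cond, c.q ⊆ p ∧ Iio a ⊆ c.S ∧
      ∀ i : Iio a, M.tdec c.q c.σ i (h i (pre b (N i))) := by
  choose f hf1 hf2 using fun (T : M.TCond) (A : {A : Set W // A.Countable}) => T.split A.2
  obtain ⟨T0, hT0, -⟩ := (Sys.triv p hp).toT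
  let AA : (List Bool → M.TCond) → {A : Set W // A.Countable} := fun T =>
    ⟨⋃ s, (T s).c.S, countable_iUnion fun s => (T s).c.cnt⟩
  let nx : (List Bool → M.TCond) → (List Bool → M.TCond) := fun T s =>
    match s with
    | [] => f (T []) (AA T) true
    | b :: s => f (T s) (AA T) b
  let L : ℕ → List Bool → M.TCond := fun n => nx^[n] (fun _ => T0)
  have hL : ∀ n, L (n+1) = nx (L n) := fun n => Function.iterate_succ_apply' nx n _
  have hAA : ∀ n s s', (L n s).c.S ⊆ (L (n+1) s').c.S := by
    intro n s s'
    refine (subset_iUnion (fun s => (L n s).c.S) s).trans ?_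
    rw [hL]
    cases s' with
    | nil => exact (hf1 (L n []) (AA (L n)) true).2.2
    | cons b s' => exact (hf1 (L n s') (AA (L n)) b).2.2
  have hle : ∀ n b s, (L (n+1) (b :: s)).c.le (L n s).c := by
    intro n b s; rw [hL]; exact (hf1 (L n s) (AA (L n)) b).2.1
  let A : Set W := ⋃ n, ⋃ s, (L n s).c.S
  have hA : A.Countable := countable_iUnion fun n => countable_iUnion fun s => (L n s).c.cnt
  have hAl : IsLowerSet A := isLowerSet_iUnion fun n => isLowerSet_iUnion fun s => (L n s).c.low
  obtain ⟨a, ha⟩ := W_lower hA hAl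
  have hN : ∀ i : Iio a, ∃ n, ∀ s, i.1 ∈ (L n s).c.S := by
    rintro ⟨i, hi⟩
    rw [← ha] at hi
    simp only [A, mem_iUnion] at hi
    obtain ⟨n, s, hi⟩ := hi
    exact ⟨n+1, fun s' => hAA n s s' hi⟩
  choose N hN using hN
  have hbr : ∀ (b : ℕ → Bool) n m, n ≤ m → (L m (pre b m)).c.le (L n (pre b n)).c := by
    intro b n m hnm
    induction m, hnm using Nat.le_induction with
    | base => exact Sys.Cond.le.refl _
    | succ m _ ih => exact (hle m (b m) (pre b m)).trans ih
  -- coherence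
  have hco : ∀ (b : ℕ → Bool) n (i : Iio a), i.1 ∈ (L n (pre b n)).c.S →
      (L n (pre b n)).t i = (L (N i) (pre b (N i))).t i := by
    intro b n i hi
    rcases le_total n (N i) with h | h
    · exact (Sys.TCond.agree' _ _ (hbr b n _ h) hi).symm
    · exact Sys.TCond.agree' _ _ (hbr b _ n h) (hN i _)
  refine ⟨a, N, fun i s => (L (N i) s).t i, ?_, ?_⟩
  · intro b b' hbb
    by_contra hne
    have hex : ∃ n, b n ≠ b' n := by by_contra! hc; exact hne (funext hc)
    classical
    let n := Nat.find hex
    have hn : b n ≠ b' n := Nat.find_spec hex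
    have hpre : pre b n = pre b' n := pre_congr fun k hk => by
      by_contra hc; exact Nat.find_min hex hk hc
    obtain ⟨i, hi, hit⟩ := hf2 (L n (pre b n)) (AA (L n))
    have e1 : L (n+1) (pre b (n+1)) = f (L n (pre b n)) (AA (L n)) (b n) := by rw [hL]; rfl
    have e2 : L (n+1) (pre b' (n+1)) = f (L n (pre b n)) (AA (L n)) (b' n) := by
      rw [hL, hpre]; rfl
    have hia : i ∈ Iio a := by
      rw [← ha]; simp only [A, mem_iUnion]
      exact ⟨n+1, pre b (n+1), by rw [e1]; exact hi _⟩
    have h1 := hco b (n+1) ⟨i, hia⟩ (by rw [e1]; exact hi _)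
    have h2 := hco b' (n+1) ⟨i, hia⟩ (by rw [e2]; exact hi _)
    rw [e1] at h1
    rw [e2] at h2
    have h3 := h1.trans ((hbb ⟨i, hia⟩).trans h2.symm)
    simp only at h3
    cases hb : b n <;> cases hb' : b' n <;> rw [hb, hb'] at hn h3
    · exact hn rfl
    · exact hit h3.symm
    · exact hit h3
    · exact hn rfl
  · intro b
    obtain ⟨d, hd1, hd2⟩ := Sys.fuse (fun n => (L n (pre b n)).c) (fun n => hle n (b n) (pre b n))
    refine ⟨d, hd1.trans hT0, ?_, ?_⟩
    · intro i hi; exact (hd2 (N ⟨i, hi⟩)).2 (hN ⟨i, hi⟩ _)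
    · intro i
      have hiS := hN i (pre b (N i))
      refine (((L (N i) (pre b (N i))).ht i hiS).mono (hd2 (N i)).1).congr fun j hj => ?_
      exact ((hd2 (N i)).agree ((L (N i) (pre b (N i))).c.low hj.le hiS)).symm

/-- distinct representatives -/
lemma exists_sdr {I Z : Type} {κ : Cardinal.{0}} (hI : #I ≤ κ) (T : I → Set Z)
    (hT : ∀ i, κ ≤ #(T i)) : ∃ x : I → Z, Function.Injective x ∧ ∀ i, x i ∈ T i := by
  obtain ⟨e⟩ : Nonempty (I ≃ (#I).ord.ToType) := by
    rw [← Cardinal.eq, Cardinal.mk_ord_toType]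
  let J := (#I).ord.ToType
  have hJ : ∀ j : J, #(Iio j) < κ := fun j => (Cardinal.mk_Iio_toType_ord_lt j).trans_le hI
  have step : ∀ (j : J) (g : ∀ k : J, k < j → Z), ∃ z ∈ T (e.symm j), ∀ k hk, g k hk ≠ z := by
    intro j g
    by_contra! hc
    have h1 : T (e.symm j) ⊆ range fun k : Iio j => g k.1 k.2 := by
      intro z hz
      obtain ⟨k, hk, h⟩ := hc z hz
      exact ⟨⟨k, hk⟩, h⟩
    have h2 := (hT (e.symm j)).trans ((Cardinal.mk_le_mk_of_subset h1).trans Cardinal.mk_range_le)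
    exact absurd (hJ j) (not_lt.mpr h2)
  choose F hF1 hF2 using step
  let x : J → Z := (wellFounded_lt (α := J)).fix F
  have hx : ∀ j, x j = F j (fun k _ => x k) := fun j => WellFounded.fix_eq _ _ _
  have hne : ∀ j k, k < j → x k ≠ x j := by
    intro j k hk
    rw [hx j]; exact hF2 j (fun k _ => x k) k hk
  refine ⟨fun i => x (e i), ?_, ?_⟩
  · intro i i' h
    rcases lt_trichotomy (e i) (e i') with h1 | h1 | h1
    · exact absurd h (hne _ _ h1)
    · exact e.injective h1
    · exact absurd h.symm (hne _ _ h1)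
  · intro i
    have := hF1 (e i) (fun k _ => x k)
    rw [← hx, e.symm_apply_apply] at this
    exact this

lemma exists_bernstein {I Z Y : Type} {κ : Cardinal.{0}} (hκ : ℵ₀ ≤ κ) (hI : #I ≤ κ) (hY : #Y ≤ κ)
    [Nonempty Y] (T : I → Set Z) (hT : ∀ i, κ ≤ #(T i)) :
    ∃ col : Z → Y, ∀ i y, ∃ z ∈ T i, col z = y := by
  have h1 : #(I × Y) ≤ κ := by
    rw [Cardinal.mk_prod]; simp only [Cardinal.lift_id]
    exact (mul_le_mul' hI hY).trans (Cardinal.mul_eq_self hκ).le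
  obtain ⟨x, hx, hxT⟩ := exists_sdr h1 (fun iy => T iy.1) (fun iy => hT iy.1)
  classical
  refine ⟨fun z => if h : ∃ iy, x iy = z then h.choose.2 else Classical.arbitrary Y, ?_⟩
  intro i y
  refine ⟨x (i, y), hxT (i, y), ?_⟩
  have h : ∃ iy, x iy = x (i, y) := ⟨_, rfl⟩
  show (if h : ∃ iy, x iy = x (i, y) then h.choose.2 else Classical.arbitrary Y) = y
  rw [dif_pos h, hx h.choose_spec]

lemma mk_G : #G = 𝔠 := by
  simp [G]

/-- the case of a large continuum -/
theorem case2 (M : Sys X) (huniv : M.Big Set.univ) (hc : (ℵ_ 2 : Cardinal.{0}) ≤ 𝔠) : Core M := by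
  have hcol : ∀ a : W, ∃ col : (Iio a → G) → Om2, ∀ (N : Iio a → ℕ) (h : Iio a → List Bool → G),
      (∀ b b' : ℕ → Bool, (∀ i, h i (pre b (N i)) = h i (pre b' (N i))) → b = b') →
      ∀ ε, ∃ b : ℕ → Bool, col (fun i => h i (pre b (N i))) = ε := by
    intro a
    have hca : Countable (Iio a) := (W_countable_Iio a).to_subtype
    let I : Type := {Nh : (Iio a → ℕ) × (Iio a → List Bool → G) //
      ∀ b b' : ℕ → Bool, (∀ i, Nh.2 i (pre b (Nh.1 i)) = Nh.2 i (pre b' (Nh.1 i))) → b = b'}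
    have hpow : ∀ (A B : Type), Countable A → #B ≤ 𝔠 → #(A → B) ≤ 𝔠 := by
      intro A B hA hB
      rw [← Cardinal.power_def]
      refine (Cardinal.power_le_power_right hB).trans ?_
      refine (Cardinal.power_le_power_left Cardinal.continuum_ne_zero
        (Cardinal.mk_le_aleph0 (α := A))).trans ?_
      exact Cardinal.continuum_power_aleph0.le
    have hI : #I ≤ 𝔠 := by
      refine (Cardinal.mk_subtype_le _).trans ?_
      rw [Cardinal.mk_prod]; simp only [Cardinal.lift_id]
      refine (mul_le_mul' (hpow _ _ hca ?_) (hpow _ _ hca (hpow _ _ inferInstance mk_G.le))).trans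
        (Cardinal.mul_eq_self Cardinal.aleph0_le_continuum).le
      exact (Cardinal.mk_le_aleph0).trans Cardinal.aleph0_le_continuum
    have hne : Nonempty Om2 := by
      rw [← Cardinal.mk_ne_zero_iff, mk_Om2]
      exact (Cardinal.aleph_pos 2).ne'
    obtain ⟨col, hcol⟩ := exists_bernstein (I := I) (Y := Om2) Cardinal.aleph0_le_continuum hI
      (by rw [mk_Om2]; exact hc)
      (fun Nh => range fun b : ℕ → Bool => fun i => Nh.1.2 i (pre b (Nh.1.1 i))) (by
        intro Nh
        rw [Cardinal.mk_range_eq _ (fun b b' h => Nh.2 b b' (fun i => congrFun h i))]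
        simp)
    refine ⟨col, fun N h hinj ε => ?_⟩
    obtain ⟨z, ⟨b, rfl⟩, hz⟩ := hcol ⟨(N, h), hinj⟩ ε
    exact ⟨b, hz⟩
  choose col hcol using hcol
  refine ⟨Set.univ, huniv, W, mk_W.le, fun ε a => {q | ∃ c : M.Cond, c.q = q ∧ Iio a ⊆ c.S ∧
    ∃ t : Iio a → G, (∀ i : Iio a, M.tdec c.q c.σ i (t i)) ∧ col a t = ε}, ?_, ?_⟩
  · rintro ε ε' a _ _ ⟨c, rfl, hc1, t, ht, rfl⟩ ⟨c', rfl, hc1', t', ht', rfl⟩ hb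
    congr 1
    funext i
    refine Sys.tdec_unique hb ((ht i).mono (Sys.Le.of_subset inter_subset_left))
      (((ht' i).mono (Sys.Le.of_subset inter_subset_right)).congr fun j hj => ?_)
    have hj' : j ∈ Iio a := lt_trans hj i.2
    exact (Sys.Cond.agree c c' hb (hc1 hj') (hc1' hj')).symm
  · intro ε p hp _
    obtain ⟨a, N, h, h1, h2⟩ := Sys.scheme p hp
    obtain ⟨b, hb⟩ := hcol a N h h1 ε
    obtain ⟨c, hc1, hc2, hc3⟩ := h2 b
    exact ⟨a, c.q, ⟨c, rfl, hc2, _, hc3, hb⟩, c.big, hc1⟩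

end BN
namespace BN
set_option linter.unusedSectionVars false
set_option linter.deprecated false

section stat
variable {Λ : Type} [LinearOrder Λ] [WellFoundedLT Λ]

def Closed (F : List Λ → Λ) (δ : Λ) : Prop := ∀ s : List Λ, (∀ x ∈ s, x < δ) → F s < δ

def Ladder (s : ℕ → Λ) (δ : Λ) : Prop := StrictMono s ∧ (∀ k, s k < δ) ∧ ∀ x < δ, ∃ k, x ≤ s k

lemma list_bound {s : ℕ → Λ} {δ : Λ} (h : Ladder s δ) (l : List Λ) (hl : ∀ x ∈ l, x < δ) :
    ∃ k, ∀ x ∈ l, x ≤ s k := by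
  induction l with
  | nil => exact ⟨0, by simp⟩
  | cons a l ih =>
    obtain ⟨k, hk⟩ := ih (fun x hx => hl x (List.mem_cons_of_mem _ hx))
    obtain ⟨k', hk'⟩ := h.2.2 a (hl a List.mem_cons_self)
    refine ⟨max k k', fun x hx => ?_⟩
    rcases List.mem_cons.mp hx with rfl | hx
    · exact hk'.trans (h.1.monotone (le_max_right _ _))
    · exact (hk x hx).trans (h.1.monotone (le_max_left _ _))

lemma lim_stat {lam : Cardinal.{0}} (hlam : ℵ_ 1 < lam) (hIio : ∀ i : Λ, #(Iio i) < lam)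
  (hbd : ∀ A : Set Λ, #A < lam → ∃ b, ∀ x ∈ A, x < b)
    (F : List Λ → Λ) (α : Λ) : ∃ δ, (∃ s, Ladder s δ) ∧ α < δ ∧ Closed F δ := by
  have hinf : ℵ₀ ≤ lam := (aleph0_lt_aleph_one'.trans hlam).le
  have hinf' : ℵ₀ < lam := (aleph0_lt_aleph_one'.trans hlam)
  have step : ∀ β : Λ, ∃ β' > β, ∀ s : List Λ, (∀ x ∈ s, x ≤ β) → F s < β' := by
    intro β
    let A : Set Λ := (range fun s : List (Iic β) => F (s.map Subtype.val)) ∪ {β}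
    have hIic : #(Iic β) < lam := by
      rw [← Iio_insert]
      exact (Cardinal.mk_insert_le).trans_lt
        (Cardinal.add_lt_of_lt hinf (hIio β) (Cardinal.one_lt_aleph0.trans_le hinf))
    have hA : #A < lam := by
      refine (Cardinal.mk_union_le _ _).trans_lt (Cardinal.add_lt_of_lt hinf ?_ ?_)
      · refine Cardinal.mk_range_le.trans_lt ((Cardinal.mk_list_le_max _).trans_lt ?_)
        exact max_lt hinf' hIic
      · rw [Cardinal.mk_singleton]; exact Cardinal.one_lt_aleph0.trans_le hinf
    obtain ⟨b, hb⟩ := hbd A hA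
    refine ⟨b, hb β (Or.inr rfl), fun s hs => hb _ (Or.inl ?_)⟩
    refine ⟨s.attach.map fun x => ⟨x.1, hs x.1 x.2⟩, ?_⟩
    simp
  choose g hg1 hg2 using step
  let s : ℕ → Λ := fun k => g^[k] (g α)
  have hs : ∀ k, s (k+1) = g (s k) := fun k => Function.iterate_succ_apply' g k _
  have hmono : StrictMono s := strictMono_nat_of_lt_succ fun k => by rw [hs]; exact hg1 _
  have hne : {b | ∀ k, s k < b}.Nonempty := by
    obtain ⟨b, hb⟩ := hbd (range s) (((Cardinal.le_aleph0_iff_set_countable).mpr (countable_range _)).trans_lt hinf')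
    exact ⟨b, fun k => hb _ (mem_range_self k)⟩
  let δ := wellFounded_lt.min {b | ∀ k, s k < b} hne
  have hδ : ∀ k, s k < δ := wellFounded_lt.min_mem {b | ∀ k, s k < b} hne
  have hlad : Ladder s δ := by
    refine ⟨hmono, hδ, fun x hx => ?_⟩
    by_contra! hc
    exact wellFounded_lt.not_lt_min {b | ∀ k, s k < b} (x := x) hc hx
  refine ⟨δ, ⟨s, hlad⟩, (hg1 α).trans (hδ 0), fun l hl => ?_⟩
  obtain ⟨k, hk⟩ := list_bound hlad l hl
  have := hg2 (s k) l hk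
  rw [← hs] at this
  exact this.trans (hδ _)

lemma exists_stat_coloring {lam : Cardinal.{0}} (hlam : ℵ_ 1 < lam) (hIio : ∀ i : Λ, #(Iio i) < lam)
  (hbd : ∀ A : Set Λ, #A < lam → ∃ b, ∀ x ∈ A, x < b) :
    ∃ (d : Λ → Om2) (η : Λ → ℕ → Λ), ∀ ε, ∀ F : List Λ → Λ, ∃ δ, d δ = ε ∧ Ladder (η δ) δ ∧
      Closed F δ := by
  have hinf' : ℵ₀ < lam := (aleph0_lt_aleph_one'.trans hlam)
  have hΛ : Nonempty Λ := by
    obtain ⟨b, -⟩ := hbd ∅ (by simpa using (aleph0_pos.trans hinf')); exact ⟨b⟩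
  have hη : ∀ δ : Λ, ∃ s : ℕ → Λ, (∃ s, Ladder s δ) → Ladder s δ := by
    intro δ
    by_cases h : ∃ s, Ladder s δ
    · exact ⟨h.choose, fun _ => h.choose_spec⟩
    · exact ⟨fun _ => hΛ.some, fun h' => absurd h' h⟩
  choose η hη using hη
  have c1 : ∃ n, ∀ α, ∀ F : List Λ → Λ, ∃ δ, Ladder (η δ) δ ∧ α ≤ η δ n ∧ Closed F δ := by
    by_contra! hc
    choose α F hF using hc
    have hs : ∀ s : List Λ, ∃ b, ∀ n, F n s < b := by
      intro s
      obtain ⟨b, hb⟩ := hbd (range fun n => F n s) (((Cardinal.le_aleph0_iff_set_countable).mpr (countable_range _)).trans_lt hinf')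
      exact ⟨b, fun n => hb _ (mem_range_self n)⟩
    choose F' hF' using hs
    obtain ⟨a, ha⟩ := hbd (range α) (((Cardinal.le_aleph0_iff_set_countable).mpr (countable_range _)).trans_lt hinf')
    obtain ⟨δ, hδ, had, hcl⟩ := lim_stat hlam hIio hbd F' a
    obtain ⟨k, hk⟩ := (hη δ hδ).2.2 a had
    exact hF k δ (hη δ hδ) ((ha _ (mem_range_self k)).le.trans hk)
      (fun s hs => (hF' s k).trans (hcl s hs))
  obtain ⟨n, hn⟩ := c1
  let B : Set Λ := {β | ∀ F : List Λ → Λ, ∃ δ, Ladder (η δ) δ ∧ η δ n = β ∧ Closed F δ}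
  have hB : ∀ α, ∃ β ∈ B, α ≤ β := by
    intro α
    by_contra! hc
    have : ∀ β : Λ, ∃ F : List Λ → Λ, α ≤ β → ∀ δ, Ladder (η δ) δ → η δ n = β → ¬ Closed F δ := by
      intro β
      by_cases hβ : α ≤ β
      · have h : β ∉ B := fun h => absurd hβ (not_le.mpr (hc β h))
        simp only [B, mem_ofPred_eq] at h
        push Not at h
        obtain ⟨F, hF⟩ := h
        exact ⟨F, fun _ => hF⟩
      · exact ⟨fun _ => α, fun h => absurd h hβ⟩
    choose F hF using this
    let F' : List Λ → Λ := fun s => match s with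
      | [] => α
      | β :: s => F β s
    obtain ⟨δ, h1, h2, h3⟩ := hn α F'
    refine hF (η δ n) h2 δ h1 rfl (fun s hs => ?_)
    refine h3 (η δ n :: s) ?_
    intro x hx
    rcases List.mem_cons.mp hx with rfl | hx
    · exact h1.2.1 n
    · exact hs x hx
  have hBc : ℵ_ 2 ≤ #B := by
    have h1 : lam ≤ #B := by
      by_contra hc
      obtain ⟨b, hb⟩ := hbd B (not_le.mp hc)
      obtain ⟨β, hβ, hbβ⟩ := hB b
      exact absurd (hb β hβ) (not_lt.mpr hbβ)
    refine le_trans ?_ h1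
    have : (ℵ_ 2 : Cardinal.{0}) = Order.succ (ℵ_ 1) := by
      rw [← Cardinal.aleph_succ]; congr 1
      rw [← Ordinal.add_one_eq_succ]; norm_num
    rw [this]
    exact Order.succ_le_of_lt hlam
  have hsurj : ∃ g : B → Om2, Function.Surjective g := by
    rw [← mk_Om2] at hBc
    obtain ⟨f⟩ := hBc
    have : Nonempty Om2 := by
      rw [← Cardinal.mk_ne_zero_iff, mk_Om2]
      exact (Cardinal.aleph_pos 2).ne'
    exact ⟨Function.invFun f, Function.invFun_surjective f.injective⟩
  obtain ⟨g, hg⟩ := hsurj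
  have : Nonempty Om2 := by
    rw [← Cardinal.mk_ne_zero_iff, mk_Om2]
    exact (Cardinal.aleph_pos 2).ne'
  classical
  refine ⟨fun δ => if h : η δ n ∈ B then g ⟨η δ n, h⟩ else Classical.arbitrary _, η, ?_⟩
  intro ε F
  obtain ⟨⟨β, hβ⟩, rfl⟩ := hg ε
  obtain ⟨δ, h1, h2, h3⟩ := hβ F
  refine ⟨δ, ?_, h1, h3⟩
  subst h2
  simp only
  rw [dif_pos hβ]

end stat

variable {X : Type} [LinearOrder X] [WellFoundedLT X]

def Dir (γ : X) : Prop := ∀ S ⊆ Iio γ, #S ≤ ℵ_ 1 → ∃ β < γ, ∀ s ∈ S, s < β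

def leStar (f g : ℕ → X) : Prop := ∃ N, ∀ n ≥ N, f n ≤ g n

lemma leStar.trans {f g h : ℕ → X} (h1 : leStar f g) (h2 : leStar g h) : leStar f h := by
  obtain ⟨N, hN⟩ := h1
  obtain ⟨N', hN'⟩ := h2
  exact ⟨max N N', fun n hn => (hN n (le_trans (le_max_left _ _) hn)).trans
    (hN' n (le_trans (le_max_right _ _) hn))⟩

lemma leStar.refl (f : ℕ → X) : leStar f f := ⟨0, fun _ _ => le_rfl⟩

/-- a scale -/
lemma exists_scale (γ : ℕ → X) (hγ : ∀ n, Dir (γ n)) :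
    ∃ (lam : Cardinal.{0}) (_ : ℵ_ 1 < lam) (f : lam.ord.ToType → ℕ → X), (∀ ξ n, f ξ n < γ n) ∧
      (∀ ζ ξ, ζ ≤ ξ → leStar (f ζ) (f ξ)) ∧
      (∀ g : ℕ → X, (∀ n, g n < γ n) → ∃ ξ, ¬ leStar (f ξ) g) ∧
      ∀ A : Set lam.ord.ToType, #A < lam → ∃ b, ∀ x ∈ A, x < b := by
  let P : Type := {f : ℕ → X // ∀ n, f n < γ n}
  let Unb : Set P → Prop := fun A => ∀ g : P, ∃ f ∈ A, ¬ leStar f.1 g.1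
  let Cs : Set Cardinal.{0} := {c | ∃ A, Unb A ∧ #A = c}
  have hsucc : ∀ g : P, ∃ f : P, ¬ leStar f.1 g.1 := by
    intro g
    have : ∀ n, ∃ β < γ n, g.1 n < β := by
      intro n
      obtain ⟨β, h1, h2⟩ := hγ n {g.1 n} (by simpa using g.2 n)
        (by rw [Cardinal.mk_singleton]; exact (Cardinal.one_lt_aleph0.trans aleph0_lt_aleph_one').le)
      exact ⟨β, h1, h2 _ rfl⟩
    choose f hf hf' using this
    refine ⟨⟨f, hf⟩, ?_⟩
    rintro ⟨N, hN⟩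
    exact absurd (hN N le_rfl) (not_le.mpr (hf' N))
  have hCs : Cs.Nonempty := ⟨_, Set.univ, fun g => by
    obtain ⟨f, hf⟩ := hsucc g; exact ⟨f, mem_univ _, hf⟩, rfl⟩
  let lam := sInf Cs
  obtain ⟨A0, hA0, hA0c⟩ : lam ∈ Cs := csInf_mem hCs
  have hbdd : ∀ A : Set P, #A < lam → ∃ g : P, ∀ f ∈ A, leStar f.1 g.1 := by
    intro A hA
    by_contra! hc
    exact absurd (csInf_le' (show #A ∈ Cs from ⟨A, hc, rfl⟩)) (not_le.mpr hA)
  have hlam : ℵ_ 1 < lam := by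
    by_contra hc
    have hc := not_lt.mp hc
    have : ∀ n, ∃ β < γ n, ∀ f ∈ A0, f.1 n < β := by
      intro n
      obtain ⟨β, h1, h2⟩ := hγ n ((fun f : P => f.1 n) '' A0)
        (by rintro _ ⟨f, _, rfl⟩; exact f.2 n)
        (Cardinal.mk_image_le.trans (hA0c.le.trans hc))
      exact ⟨β, h1, fun f hf => h2 _ ⟨f, hf, rfl⟩⟩
    choose g hg hg' using this
    obtain ⟨f, hf, hn⟩ := hA0 ⟨g, hg⟩
    exact hn ⟨0, fun n _ => (hg' n f hf).le⟩
  have hinf : ℵ₀ ≤ lam := (aleph0_lt_aleph_one'.trans hlam).le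
  let Λ := lam.ord.ToType
  obtain ⟨e⟩ : Nonempty (Λ ≃ A0) := by
    rw [← Cardinal.eq, Cardinal.mk_ord_toType, hA0c]
  have hIio : ∀ i : Λ, #(Iio i) < lam := fun i => Cardinal.mk_Iio_toType_ord_lt i
  have step : ∀ (ξ : Λ) (g : ∀ ζ : Λ, ζ < ξ → P), ∃ h : P, leStar (e ξ).1.1 h.1 ∧
      ∀ ζ hζ, leStar (g ζ hζ).1 h.1 := by
    intro ξ g
    obtain ⟨h, hh⟩ := hbdd ((range fun ζ : Iio ξ => g ζ.1 ζ.2) ∪ {(e ξ).1}) (by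
      refine (Cardinal.mk_union_le _ _).trans_lt (Cardinal.add_lt_of_lt hinf ?_ ?_)
      · exact Cardinal.mk_range_le.trans_lt (hIio ξ)
      · rw [Cardinal.mk_singleton]; exact Cardinal.one_lt_aleph0.trans_le hinf)
    exact ⟨h, hh _ (Or.inr rfl), fun ζ hζ => hh _ (Or.inl ⟨⟨ζ, hζ⟩, rfl⟩)⟩
  choose F hF1 hF2 using step
  let f : Λ → P := (wellFounded_lt (α := Λ)).fix F
  have hf : ∀ j, f j = F j (fun k _ => f k) := fun j => WellFounded.fix_eq _ _ _
  have hmono : ∀ ζ ξ, ζ ≤ ξ → leStar (f ζ).1 (f ξ).1 := by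
    intro ζ ξ h
    rcases h.eq_or_lt with rfl | h
    · exact leStar.refl _
    · rw [hf ξ]; exact hF2 ξ (fun k _ => f k) ζ h
  have hunb : ∀ g : P, ∃ ξ, ¬ leStar (f ξ).1 g.1 := by
    intro g
    obtain ⟨a, ha, hag⟩ := hA0 g
    refine ⟨e.symm ⟨a, ha⟩, fun h => hag (leStar.trans ?_ h)⟩
    have := hF1 (e.symm ⟨a, ha⟩) (fun k _ => f k)
    rw [← hf, e.apply_symm_apply] at this
    exact this
  refine ⟨lam, hlam, fun ξ => (f ξ).1, fun ξ => (f ξ).2, hmono, fun g hg => hunb ⟨g, hg⟩, ?_⟩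
  intro A hA
  by_contra! hc
  obtain ⟨g, hg⟩ := hbdd (f '' A) (Cardinal.mk_image_le.trans_lt hA)
  obtain ⟨ξ, hξ⟩ := hunb g
  obtain ⟨ζ, hζ, hle⟩ := hc ξ
  exact hξ ((hmono ξ ζ hle).trans (hg _ ⟨ζ, hζ, rfl⟩))

end BN
namespace BN
set_option linter.unusedSectionVars false
set_option linter.deprecated false

def cont {Λ : Type} (s : List Λ) (ξ : Λ) (n : ℕ) : Λ := s.reverse.getD n ξ

lemma cont_pre {Λ : Type} (z : ℕ → Λ) (L : ℕ) (ξ : Λ) (n : ℕ) :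
    cont (pre z L) ξ n = if n < L then z n else ξ := by
  have h : ∀ L, (pre z L).reverse = (List.range L).map z := by
    intro L
    induction L with
    | zero => rfl
    | succ L ih =>
      show (z L :: pre z L).reverse = _
      rw [List.reverse_cons, ih, List.range_succ, List.map_append]; rfl
  unfold cont
  rw [h]
  split_ifs with hn
  · simp [List.getD_eq_getElem?_getD, hn]
  · simp [List.getD_eq_getElem?_getD, hn]

variable {X : Type} [LinearOrder X] [WellFoundedLT X]

lemma exists_zeta {Λ : Type} [LinearOrder Λ] (f : Λ → ℕ → X) 
    (hfm : ∀ ζ ξ, ζ ≤ ξ → leStar (f ζ) (f ξ)) (V : (ℕ → Λ) → ℕ → X)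
    (hV : ∀ z n, f (z n) n ≤ V z n) (hVc : ∀ z z' n, (∀ k ≤ n, z k = z' k) → V z n = V z' n)
    (F : List Λ → Λ) (hF : ∀ s ξ, ¬ leStar (f (F (ξ :: s))) (V (cont s ξ)))
    (δ : Λ) (hcl : Closed F δ) (ξ : ℕ → Λ) (hlad : Ladder ξ δ) :
    ∃ ζ : ℕ → Λ, ¬ leStar (f δ) (V ζ) ∧ ∀ α < δ, leStar (f α) (V ζ) := by
  have hN : ∀ k, ∃ N, ∀ n ≥ N, ∀ j ≤ k, f (ξ j) n ≤ f (ξ (k+1)) n := by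
    intro k
    have : ∀ j, ∃ N, j ≤ k → ∀ n ≥ N, f (ξ j) n ≤ f (ξ (k+1)) n := by
      intro j
      by_cases hj : j ≤ k
      · obtain ⟨N, hN⟩ := hfm (ξ j) (ξ (k+1)) (hlad.1.monotone (by omega))
        exact ⟨N, fun _ => hN⟩
      · exact ⟨0, fun h => absurd h hj⟩
    choose N hN using this
    refine ⟨(Finset.range (k+1)).sup N, fun n hn j hj => hN j hj n (le_trans ?_ hn)⟩
    exact Finset.le_sup (f := N) (Finset.mem_range.mpr (by omega))
  choose N hN using hN
  have step : ∀ (k : ℕ) (z : {z : ℕ → Λ // ∀ n, z n < δ}) (L : ℕ),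
      ∃ p : {z : ℕ → Λ // ∀ n, z n < δ} × ℕ, (∀ n < L, p.1.1 n = z.1 n) ∧
        (∀ n ≥ L, p.1.1 n = ξ k) ∧ L < p.2 ∧ N k ≤ p.2 ∧
        ∃ n, L ≤ n ∧ n < p.2 ∧ V p.1.1 n < f δ n := by
    intro k z L
    have hz : ∀ n, cont (pre z.1 L) (ξ k) n < δ := by
      intro n; rw [cont_pre]; split_ifs
      · exact z.2 n
      · exact hlad.2.1 k
    have hFd : F (ξ k :: pre z.1 L) < δ := by
      refine hcl _ ?_
      intro x hx
      rcases List.mem_cons.mp hx with rfl | hx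
      · exact hlad.2.1 k
      · have : ∀ M, ∀ x ∈ pre z.1 M, x < δ := by
          intro M
          induction M with
          | zero => intro x hx; simp [pre] at hx
          | succ M ih =>
            intro x hx
            rcases List.mem_cons.mp hx with rfl | hx
            · exact z.2 M
            · exact ih x hx
        exact this L x hx
    have h1 : ∃ n ≥ L, V (cont (pre z.1 L) (ξ k)) n < f δ n := by
      by_contra! hc
      exact hF (pre z.1 L) (ξ k) ((hfm _ _ hFd.le).trans ⟨L, hc⟩)
    obtain ⟨n, hn, hlt⟩ := h1
    refine ⟨(⟨_, hz⟩, max (n+1) (N k)), ?_, ?_, ?_, ?_, n, hn, ?_, hlt⟩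
    · intro m hm; simp only [cont_pre, if_pos hm]
    · intro m hm; simp only [cont_pre, if_neg (not_lt.mpr hm)]
    · simp only [lt_max_iff]; left; omega
    · exact le_max_right _ _
    · simp only [lt_max_iff]; left; omega
  choose g hg1 hg2 hg3 hg4 hg5 using step
  let st : ℕ → {z : ℕ → Λ // ∀ n, z n < δ} × ℕ :=
    fun k => Nat.rec (⟨fun _ => ξ 0, fun _ => hlad.2.1 0⟩, 0) (fun k v => g k v.1 v.2) k
  have hst : ∀ k, st (k+1) = g k (st k).1 (st k).2 := fun k => rfl
  let z : ℕ → ℕ → Λ := fun k => (st k).1.1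
  let ℓ : ℕ → ℕ := fun k => (st k).2
  have z1 : ∀ k, ∀ n < ℓ k, z (k+1) n = z k n := fun k n hn => hg1 k _ _ n hn
  have z2 : ∀ k, ∀ n ≥ ℓ k, z (k+1) n = ξ k := fun k n hn => hg2 k _ _ n hn
  have z3 : ∀ k, ℓ k < ℓ (k+1) := fun k => hg3 k _ _
  have z4 : ∀ k, N k ≤ ℓ (k+1) := fun k => hg4 k _ _
  have z5 : ∀ k, ∃ n, ℓ k ≤ n ∧ n < ℓ (k+1) ∧ V (z (k+1)) n < f δ n := fun k => hg5 k _ _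
  have hsm : StrictMono ℓ := strictMono_nat_of_lt_succ z3
  have hstab : ∀ k k', k ≤ k' → ∀ n < ℓ k, z k' n = z k n := by
    intro k k' h
    induction k', h using Nat.le_induction with
    | base => intro n _; rfl
    | succ k' hk ih =>
      intro n hn
      rw [z1 k' n (hn.trans_le (hsm.monotone hk)), ih n hn]
  let ζ : ℕ → Λ := fun n => z (n+1) n
  have hζ : ∀ k, ∀ n < ℓ k, ζ n = z k n := by
    intro k n hn
    rcases le_total k (n+1) with h | h
    · exact hstab k _ h n hn
    · refine (hstab _ k h n ?_).symm
      exact lt_of_lt_of_le (Nat.lt_succ_self n) hsm.le_apply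
  refine ⟨ζ, ?_, ?_⟩
  · rintro ⟨K, hK⟩
    obtain ⟨n, h1, h2, h3⟩ := z5 K
    have h4 := hK n (hsm.le_apply.trans h1)
    rw [hVc ζ (z (K+1)) n (fun m hm => hζ (K+1) m (hm.trans_lt h2))] at h4
    exact absurd h3 (not_lt.mpr h4)
  · intro α hα
    obtain ⟨k, hk⟩ := hlad.2.2 α hα
    refine (hfm _ _ hk).trans ⟨ℓ k, ?_⟩
    have key : ∀ j, k ≤ j → ∀ n, ℓ k ≤ n → n < ℓ j → f (ξ k) n ≤ V ζ n := by
      intro j hj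
      induction j, hj using Nat.le_induction with
      | base => intro n h1 h2; omega
      | succ j hj ih =>
        intro n h1 h2
        by_cases h3 : n < ℓ j
        · exact ih n h1 h3
        · have h3 := not_lt.mp h3
          refine le_trans ?_ (hV ζ n)
          rw [hζ (j+1) n h2, z2 j n h3]
          rcases hj.eq_or_lt with rfl | hj
          · exact le_rfl
          · obtain ⟨j, rfl⟩ : ∃ i, j = i + 1 := ⟨j-1, by omega⟩
            exact hN j n ((z4 j).trans h3) k (by omega)
    intro n hn
    refine key (max k (n+1)) (le_max_left _ _) n hn ?_
    exact lt_of_lt_of_le (Nat.lt_succ_self n) ((le_max_right k (n+1)).trans hsm.le_apply)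

theorem coloring (γ : ℕ → X) (hγ : ∀ n, Dir (γ n)) : ∃ c : (ℕ → X) → Om2,
    ∀ (T : Set (List X)) (val : List X → X), [] ∈ T →
      (∀ l ∈ T, ∀ β < γ l.length, ∃ β', β' :: l ∈ T ∧ β ≤ val (β' :: l) ∧
        val (β' :: l) < γ l.length) →
      ∀ ε, ∃ y : ℕ → X, (∀ n, pre y n ∈ T) ∧ c (fun n => val (pre y (n+1))) = ε := by
  classical
  obtain ⟨lam, hlam, f, hf, hfm, hunb, hbd⟩ := exists_scale γ hγ
  obtain ⟨d, η, hd⟩ := exists_stat_coloring hlam (fun i => Cardinal.mk_Iio_toType_ord_lt i) hbd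
  have hΛ : Nonempty lam.ord.ToType := by
    obtain ⟨b, -⟩ := hbd ∅ (by simpa using (aleph0_pos.trans (aleph0_lt_aleph_one'.trans hlam)))
    exact ⟨b⟩
  refine ⟨fun v => if h : {ξ | ¬ leStar (f ξ) v}.Nonempty then d (wellFounded_lt.min _ h)
    else d hΛ.some, ?_⟩
  intro T val hT0 hT ε
  have hnx : ∀ l β, ∃ β', l ∈ T → β < γ l.length → (β' :: l ∈ T ∧ β ≤ val (β' :: l) ∧
        val (β' :: l) < γ l.length) := by
    intro l β
    by_cases h : l ∈ T ∧ β < γ l.length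
    · obtain ⟨β', h'⟩ := hT l h.1 β h.2
      exact ⟨β', fun _ _ => h'⟩
    · exact ⟨γ 0, fun h1 h2 => absurd ⟨h1, h2⟩ h⟩
  choose nxt hnx using hnx
  let pos : List lam.ord.ToType → List X := fun s => List.rec [] (fun ξ s v => nxt v (f ξ s.length) :: v) s
  have pos_cons : ∀ ξ s, pos (ξ :: s) = nxt (pos s) (f ξ s.length) :: pos s := fun _ _ => rfl
  have pos_len : ∀ s, (pos s).length = s.length := by
    intro s
    induction s with
    | nil => rfl
    | cons ξ s ih => rw [pos_cons, List.length_cons, ih, List.length_cons]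
  have hpos : ∀ s, pos s ∈ T := by
    intro s
    induction s with
    | nil => exact hT0
    | cons ξ s ih =>
      rw [pos_cons]
      exact (hnx _ _ ih (by rw [pos_len]; exact hf _ _)).1
  have hval : ∀ ξ s, f ξ s.length ≤ val (pos (ξ :: s)) ∧ val (pos (ξ :: s)) < γ s.length := by
    intro ξ s
    have := (hnx _ (f ξ s.length) (hpos s) (by rw [pos_len]; exact hf _ _)).2
    rw [pos_len] at this
    exact this
  let V : (ℕ → lam.ord.ToType) → ℕ → X := fun z n => val (pos (pre z (n+1)))
  have hV : ∀ z n, f (z n) n ≤ V z n ∧ V z n < γ n := by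
    intro z n
    have := hval (z n) (pre z n)
    rw [pre_length] at this
    exact this
  have hFe : ∀ s : List lam.ord.ToType, ∃ ξ', ∀ ξ t, s = ξ :: t → ¬ leStar (f ξ') (V (cont t ξ)) := by
    intro s
    cases s with
    | nil => exact ⟨hΛ.some, by simp⟩
    | cons ξ t =>
      obtain ⟨ξ', h⟩ := hunb (V (cont t ξ)) (fun n => (hV _ n).2)
      refine ⟨ξ', fun a b hab => ?_⟩
      simp only [List.cons.injEq] at hab
      rw [← hab.1, ← hab.2]; exact h
  choose F hF using hFe
  obtain ⟨δ, hδ, hlad, hcl⟩ := hd ε F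
  obtain ⟨ζ, h1, h2⟩ := exists_zeta f hfm V (fun z n => (hV z n).1) (by
    intro z z' n h
    show val (pos (pre z (n+1))) = val (pos (pre z' (n+1)))
    rw [pre_congr (fun k hk => h k (by omega))]) F (fun s ξ => hF _ ξ s rfl) δ hcl _ hlad
  let y : ℕ → X := fun n => nxt (pos (pre ζ n)) (f (ζ n) (pre ζ n).length)
  have hy : ∀ n, pre y n = pos (pre ζ n) := by
    intro n
    induction n with
    | zero => rfl
    | succ n ih =>
      show y n :: pre y n = _
      rw [ih]; rfl
  refine ⟨y, fun n => by rw [hy]; exact hpos _, ?_⟩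
  have hyV : (fun n => val (pre y (n+1))) = V ζ := by
    funext n; rw [hy]
  rw [hyV]
  have hne : {ξ | ¬ leStar (f ξ) (V ζ)}.Nonempty := ⟨δ, h1⟩
  beta_reduce
  rw [dif_pos hne, ← hδ]
  congr 1
  refine le_antisymm ?_ ?_
  · exact not_lt.mp (wellFounded_lt.not_lt_min _ (x := δ) h1)
  · by_contra hc
    exact (wellFounded_lt.min_mem _ hne) (h2 _ (not_le.mp hc))

end BN
namespace BN
set_option linter.unusedSectionVars false
set_option linter.deprecated false

variable {X : Type} [LinearOrder X] [WellFoundedLT X]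

section tree
variable {J : Type} (γ : J → X) (jn : List X → J) (a : ℕ → J)

inductive BadR : Ordinal.{0} → List X → Prop
  | base (α : Ordinal.{0}) (l : List X) (h : jn l ≠ a l.length) : BadR α l
  | step (α : Ordinal.{0}) (l : List X) (β : X) (r : X → Ordinal.{0}) (hβ : β < γ (jn l))
      (hr : ∀ β', β ≤ β' → β' < γ (jn l) → r β' < α)
      (h : ∀ β', β ≤ β' → β' < γ (jn l) → BadR (r β') (β' :: l)) : BadR α l

lemma BadR.up (l : List X) (β : X) (hβ : β < γ (jn l))
    (h : ∀ β', β ≤ β' → β' < γ (jn l) → ∃ α, BadR γ jn a α (β' :: l)) :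
    ∃ α, BadR γ jn a α l := by
  have : ∀ β', ∃ α, β ≤ β' → β' < γ (jn l) → BadR γ jn a α (β' :: l) := by
    intro β'
    by_cases h1 : β ≤ β' ∧ β' < γ (jn l)
    · obtain ⟨α, hα⟩ := h β' h1.1 h1.2; exact ⟨α, fun _ _ => hα⟩
    · exact ⟨0, fun h2 h3 => absurd ⟨h2, h3⟩ h1⟩
  choose r hr using this
  refine ⟨⨆ β', Order.succ (r β'), BadR.step _ l β r hβ (fun β' _ _ => ?_) hr⟩
  exact (Order.lt_succ _).trans_le (Ordinal.le_iSup (fun β' => Order.succ (r β')) β')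

lemma exists_tree (hγ : ∀ j, Dir (γ j)) (hJ : #(ℕ → J) ≤ ℵ_ 1) :
    ∃ (a : ℕ → J) (T : Set (List X)), [] ∈ T ∧ ∀ l ∈ T, jn l = a l.length ∧
      ∀ β < γ (jn l), ∃ β', β ≤ β' ∧ β' < γ (jn l) ∧ β' :: l ∈ T := by
  have main : ∃ a : ℕ → J, ¬ ∃ α, BadR γ jn a α [] := by
    by_contra! hc
    let rk : (ℕ → J) → List X → Ordinal.{0} := fun a l => sInf {α | BadR γ jn a α l}
    have wit : ∀ a l, ∃ β < γ (jn l), jn l = a l.length → (∃ α, BadR γ jn a α l) →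
        ∀ β', β ≤ β' → β' < γ (jn l) → (∃ α, BadR γ jn a α (β' :: l)) ∧
          rk a (β' :: l) < rk a l := by
      intro a l
      by_cases hb : jn l = a l.length ∧ ∃ α, BadR γ jn a α l
      · obtain ⟨h1, h2⟩ := hb
        have h3 : BadR γ jn a (rk a l) l := csInf_mem (s := {α | BadR γ jn a α l}) h2
        cases h3 with
        | base _ _ h => exact absurd h1 h
        | step _ _ β r hβ hr h =>
          refine ⟨β, hβ, fun _ _ β' h4 h5 => ⟨⟨_, h β' h4 h5⟩, ?_⟩⟩
          exact (csInf_le' (show r β' ∈ {α | BadR γ jn a α (β' :: l)} from h β' h4 h5)).trans_lt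
            (hr β' h4 h5)
      · obtain ⟨β, h1, -⟩ := hγ (jn l) ∅ (empty_subset _) (by simp)
        exact ⟨β, h1, fun h2 h3 => absurd ⟨h2, h3⟩ hb⟩
    choose β hβ hwit using wit
    have hg : ∀ l, ∃ g < γ (jn l), ∀ a, β a l ≤ g := by
      intro l
      obtain ⟨g, h1, h2⟩ := hγ (jn l) (range fun a => β a l) (by rintro _ ⟨a, rfl⟩; exact hβ a l)
        (Cardinal.mk_range_le.trans hJ)
      exact ⟨g, h1, fun a => (h2 _ (mem_range_self a)).le⟩
    choose g hg1 hg2 using hg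
    let ls : ℕ → List X := fun n => Nat.rec [] (fun _ l => g l :: l) n
    have hls : ∀ n, ls (n+1) = g (ls n) :: ls n := fun _ => rfl
    have hlen : ∀ n, (ls n).length = n := by
      intro n
      induction n with
      | zero => rfl
      | succ n ih => rw [hls, List.length_cons, ih]
    let a : ℕ → J := fun n => jn (ls n)
    have hja : ∀ n, jn (ls n) = a (ls n).length := fun n => by rw [hlen]
    have hbad : ∀ n, ∃ α, BadR γ jn a α (ls n) := by
      intro n
      induction n with
      | zero => exact hc a
      | succ n ih => exact (hwit a (ls n) (hja n) ih (g (ls n)) (hg2 _ _) (hg1 _)).1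
    have hlt : ∀ n, rk a (ls (n+1)) < rk a (ls n) := fun n =>
      (hwit a (ls n) (hja n) (hbad n) (g (ls n)) (hg2 _ _) (hg1 _)).2
    exact not_strictAnti_of_wellFoundedLT (fun n => rk a (ls n)) (strictAnti_nat_of_succ_lt hlt)
  obtain ⟨a, ha⟩ := main
  refine ⟨a, {l | ¬ ∃ α, BadR γ jn a α l}, ha, fun l hl => ⟨?_, fun β hβ => ?_⟩⟩
  · by_contra hne
    exact hl ⟨0, BadR.base _ _ hne⟩
  · by_contra! hc
    refine hl (BadR.up γ jn a l β hβ fun β' h1 h2 => ?_)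
    by_contra h3
    exact hc β' h1 h2 (not_exists.mp h3)

end tree

variable (M : Sys X)

def Sys.Val (q : Set X) (i : W) (n : ℕ) (y : X) : Prop :=
  ∃ c : M.Cond, M.Le c.q q ∧ i ∈ c.S ∧ c.σ i n = y

variable {M}

lemma Sys.Val.mono {q q' : Set X} {i : W} {n : ℕ} {y : X} (h : M.Val q i n y) (hle : M.Le q q') :
    M.Val q' i n y := by
  obtain ⟨c, h1, h2⟩ := h
  exact ⟨c, h1.trans hle, h2⟩

lemma Sys.uncovered {p : Set X} (hp : M.Big p) (Y : Set X) (hY : #Y ≤ ℵ_ 1) :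
    ∃ i n y, y ∉ Y ∧ M.Val p i n y := by
  classical
  by_contra! hc
  have hcY : ∀ c : M.Cond, M.Le c.q p → ∀ i ∈ c.S, ∀ n, c.σ i n ∈ Y := by
    intro c hc1 i hi n
    by_contra hn
    exact hc i n _ hn ⟨c, hc1, hi, rfl⟩
  have hχ : ∀ x : X, ∃ o : Option Y, ∀ y ∈ Y, x < y ↔ ∃ z, o = some z ∧ z.1 ≤ y := by
    intro x
    by_cases hne : {y | y ∈ Y ∧ x < y}.Nonempty
    · have hm := wellFounded_lt.min_mem _ hne
      refine ⟨some ⟨_, hm.1⟩, fun y hy => ?_⟩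
      constructor
      · intro h
        exact ⟨_, rfl, not_lt.mp (wellFounded_lt.not_lt_min {y | y ∈ Y ∧ x < y} (x := y) ⟨hy, h⟩)⟩
      · rintro ⟨z, hz, hle⟩
        simp only [Option.some.injEq] at hz
        rw [← hz] at hle
        exact hm.2.trans_le hle
    · refine ⟨none, fun y hy => ⟨fun h => absurd ⟨y, hy, h⟩ hne, ?_⟩⟩
      rintro ⟨z, hz, -⟩; cases hz
  choose χ hχ using hχ
  obtain ⟨p', hp's, hp', ζ, hζ⟩ := hp.homog χ (by
    rw [Cardinal.mk_option]
    exact Cardinal.add_lt_of_lt Sys.aleph0_le (hY.trans_lt Sys.aleph1_lt)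
      (Cardinal.one_lt_aleph0.trans_le Sys.aleph0_le))
  have hsame : ∀ x ∈ p', ∀ x' ∈ p', M.bl x = M.bl x' → ∀ y ∈ Y, x < y ↔ x' < y := by
    intro x hx x' hx' hb y hy
    rw [hχ x y hy, hχ x' y hy, hζ x hx, hζ x' hx', hb]
  let Q : Type := {c : M.Cond // M.Le c.q p'}
  let D : Q → ℕ → Set W := fun c n => {i | i ∈ c.1.S ∧ ∃ x ∈ p', M.bl x = n ∧ x ∈ M.C c.1.σ i (c.1.σ i)}
  have hD : ∀ c n, (D c n).Finite := by
    intro c n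
    have hcp : M.Le c.1.q p := c.2.trans (Sys.Le.of_subset hp's)
    by_cases hne : ∃ x ∈ p', M.bl x = n
    · obtain ⟨x, hx, hxn⟩ := hne
      refine (Sys.C_finite (M := M) c.1.σ x).subset ?_
      rintro i ⟨hi, x', hx', hb, h1, h2⟩
      have hb' : M.bl x' = M.bl x := hb.trans hxn.symm
      have e : ∀ j ≤ i, x' < c.1.σ j (M.bl x) ↔ x < c.1.σ j (M.bl x) := fun j hj =>
        hsame x' hx' x hx hb' _ (hcY c.1 hcp j (c.1.low hj hi) _)
      rw [hb'] at h1 h2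
      refine ⟨(e i le_rfl).mp h1, fun j hj hlt => h2 j hj ((e j hj.le).mpr hlt)⟩
    · refine (finite_empty).subset ?_
      rintro i ⟨hi, x', hx', hb, _⟩
      exact hne ⟨x', hx', hb⟩
  have hDm : ∀ (u v : Q) n, v.1.le u.1 → D u n ⊆ D v n := by
    rintro u v n h i ⟨hi, x, hx, hb, hC⟩
    refine ⟨h.2 hi, x, hx, hb, ?_⟩
    rw [h.C_eq hi]; exact hC
  obtain ⟨u, hu⟩ := no_mono (Q := Q) (Z := ℕ) (fun v u => v.1.le u.1)
    (fun u v w h h' => h.trans h') (fun u => Sys.Cond.le.refl _)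
    (by
      intro u hu
      obtain ⟨d, -, hd⟩ := Sys.fuse (fun k => (u k).1) hu
      exact ⟨⟨d, (hd 0).1.trans (u 0).2⟩, hd⟩)
    (fun c n => (D c n).ncard) (fun u v n h => ncard_le_ncard (hDm u v n h) (hD v n))
    ⟨Sys.triv p' hp', Sys.Le.refl _⟩
  obtain ⟨i, hi⟩ := W_not_countable u.1.cnt
  obtain ⟨v, hvq, hvu, hiv⟩ := u.1.extend i
  have hvp : M.Le v.q p' := hvu.1.trans u.2
  have hb : M.Big ((v.q ∩ p') \ (v.q \ M.C v.σ i (v.σ i))) :=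
    (v.big.inter_of_le hvp).of_diff (v.dec i hiv).1
  obtain ⟨x, ⟨hx1, hx2⟩, hx3⟩ := hb.nonempty
  have hxC : x ∈ M.C v.σ i (v.σ i) := by
    by_contra h; exact hx3 ⟨hx1, h⟩
  have heq := hu ⟨v, hvp⟩ hvu (M.bl x)
  have : D u (M.bl x) = D ⟨v, hvp⟩ (M.bl x) :=
    Set.eq_of_subset_of_ncard_le (hDm u ⟨v, hvp⟩ _ hvu) heq.le (hD _ _)
  have hmem : i ∈ D ⟨v, hvp⟩ (M.bl x) := ⟨hiv, x, hx2, rfl, hxC⟩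
  rw [← this] at hmem
  exact hi hmem.1

variable (M) in
def Sys.Full (q : Set X) (i : W) (n : ℕ) (γ : X) : Prop :=
  ∀ β < γ, ∃ y, β ≤ y ∧ y < γ ∧ M.Val q i n y

lemma Sys.lemmaA (huniv : M.Big Set.univ)
    (hcof : ∃ Γ0 : Set X, #Γ0 ≤ ℵ_ 1 ∧ ∀ x, ∃ u ∈ Γ0, x < u) :
    ∃ p0, M.Big p0 ∧ ∃ Γ : Set X, #Γ ≤ ℵ_ 1 ∧ ∀ q, M.Big q → M.Le q p0 →
      ∃ i n, ∃ γ ∈ Γ, Dir γ ∧ M.Full q i n γ := by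
  by_contra! hc
  let St : Type := {z : Set X × Set X // M.Big z.1 ∧ #z.2 ≤ ℵ_ 1}
  have step : ∀ z : St, ∃ z' : St, M.Le z'.1.1 z.1.1 ∧ z.1.2 ⊆ z'.1.2 ∧
      ∀ i n y, M.Val z'.1.1 i n y → y ∉ z'.1.2 → ∀ γ ∈ z.1.2, y < γ → ∃ γ' ∈ z'.1.2, y < γ' ∧ γ' < γ := by
    rintro ⟨⟨q, Γ⟩, hq, hΓ⟩
    obtain ⟨q', hq', hle, hnf⟩ := hc q hq Γ hΓ
    have h1 : ∀ (i : W) (n : ℕ) (γ : Γ), ∃ β : X, Dir γ.1 → β < γ.1 ∧ ∀ y, β ≤ y → y < γ.1 →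
        ¬ M.Val q' i n y := by
      intro i n γ
      by_cases hd : Dir γ.1
      · have := hnf i n γ.1 γ.2 hd
        unfold Sys.Full at this
        push Not at this
        obtain ⟨β, h1, h2⟩ := this
        exact ⟨β, fun _ => ⟨h1, h2⟩⟩
      · exact ⟨γ.1, fun h => absurd h hd⟩
    choose h hh using h1
    have h2 : ∀ γ : Γ, ∃ S : Set X, S ⊆ Iio γ.1 ∧ #S ≤ ℵ_ 1 ∧ (¬ Dir γ.1 → ∀ β < γ.1, ∃ s ∈ S, β ≤ s) := by
      intro γ
      by_cases hd : Dir γ.1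
      · exact ⟨∅, empty_subset _, by simp, fun h => absurd hd h⟩
      · have hd' := hd
        unfold Dir at hd'
        push Not at hd'
        obtain ⟨S, h1, h2, h3⟩ := hd'
        exact ⟨S, h1, h2, fun _ => h3⟩
    choose S hS1 hS2 hS3 using h2
    have hω : (ℵ₀ : Cardinal.{0}) ≤ ℵ_ 1 := aleph0_lt_aleph_one'.le
    have hmul : ∀ c d : Cardinal.{0}, c ≤ ℵ_ 1 → d ≤ ℵ_ 1 → c * d ≤ ℵ_ 1 := fun c d h1 h2 =>
      (mul_le_mul' h1 h2).trans (Cardinal.mul_eq_self hω).le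
    have hadd : ∀ c d : Cardinal.{0}, c ≤ ℵ_ 1 → d ≤ ℵ_ 1 → c + d ≤ ℵ_ 1 := fun c d h1 h2 =>
      (add_le_add h1 h2).trans (Cardinal.add_eq_self hω).le
    let Γ' : Set X := Γ ∪ ((range fun z : W × ℕ × Γ => h z.1 z.2.1 z.2.2) ∪ ⋃ γ, S γ)
    have hΓ' : #Γ' ≤ ℵ_ 1 := by
      refine (Cardinal.mk_union_le _ _).trans (hadd _ _ hΓ ((Cardinal.mk_union_le _ _).trans
        (hadd _ _ ?_ ?_)))
      · refine Cardinal.mk_range_le.trans ?_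
        rw [Cardinal.mk_prod, Cardinal.lift_id, Cardinal.lift_id, Cardinal.mk_prod,
          Cardinal.lift_id, Cardinal.lift_id]
        refine hmul _ _ mk_W.le (hmul _ _ ?_ hΓ)
        rw [Cardinal.mk_nat]; exact hω
      · exact (Cardinal.mk_iUnion_le S).trans (hmul _ _ hΓ (ciSup_le' hS2))
    refine ⟨⟨⟨q', Γ'⟩, hq', hΓ'⟩, hle, subset_union_left, ?_⟩
    intro i n y hy hyn γ hγ hlt
    by_cases hd : Dir γ
    · obtain ⟨h3, h4⟩ := hh i n ⟨γ, hγ⟩ hd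
      refine ⟨h i n ⟨γ, hγ⟩, Or.inr (Or.inl ⟨(i, n, ⟨γ, hγ⟩), rfl⟩), ?_, h3⟩
      by_contra h5
      exact h4 y (not_lt.mp h5) hlt hy
    · obtain ⟨s, hs, hle'⟩ := hS3 ⟨γ, hγ⟩ hd y hlt
      have hsΓ : s ∈ Γ' := Or.inr (Or.inr (mem_iUnion.mpr ⟨_, hs⟩))
      refine ⟨s, hsΓ, lt_of_le_of_ne hle' ?_, hS1 _ hs⟩
      rintro rfl
      exact hyn hsΓ
  choose nx hn1 hn2 hn3 using step
  obtain ⟨Γ0, hΓ0, hΓ0c⟩ := hcof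
  let st : ℕ → St := fun k => nx^[k] ⟨(Set.univ, Γ0), huniv, hΓ0⟩
  have hst : ∀ k, st (k+1) = nx (st k) := fun k => Function.iterate_succ_apply' nx k _
  obtain ⟨r, -, hr, hrl⟩ := Sys.lower_bound (M := M) (fun k => (st k).1.1) (fun k => (st k).2.1)
    (fun k => by rw [hst]; exact hn1 _)
  obtain ⟨i, n, y, hy, hval⟩ := Sys.uncovered hr (⋃ k, (st k).1.2) (by
    refine (Cardinal.mk_iUnion_le _).trans ?_
    refine (mul_le_mul' ?_ (ciSup_le' fun k => (st k).2.2)).trans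
      (Cardinal.mul_eq_self aleph0_lt_aleph_one'.le).le
    rw [Cardinal.mk_nat]; exact aleph0_lt_aleph_one'.le)
  have hex : ∀ k, {u | u ∈ (st k).1.2 ∧ y < u}.Nonempty := by
    intro k
    induction k with
    | zero =>
      obtain ⟨u, h1, h2⟩ := hΓ0c y
      exact ⟨u, h1, h2⟩
    | succ k ih =>
      obtain ⟨u, h1, h2⟩ := ih
      refine ⟨u, ?_, h2⟩
      rw [hst]; exact hn2 _ h1
  let u : ℕ → X := fun k => wellFounded_lt.min _ (hex k)
  have hu : ∀ k, u (k+1) < u k := by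
    intro k
    have h1 := wellFounded_lt.min_mem _ (hex k)
    obtain ⟨γ', h2, h3, h4⟩ := hn3 (st k) i n y (by rw [← hst]; exact hval.mono (hrl _))
      (by rw [← hst]; exact fun h => hy (mem_iUnion.mpr ⟨_, h⟩)) (u k) h1.1 h1.2
    rw [← hst] at h2
    exact (not_lt.mp (wellFounded_lt.not_lt_min {u | u ∈ (st (k+1)).1.2 ∧ y < u} (x := γ') ⟨h2, h3⟩)).trans_lt h4
  exact not_strictAnti_of_wellFoundedLT _ (strictAnti_nat_of_succ_lt hu)

theorem case1 (M : Sys X) (huniv : M.Big Set.univ)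
    (hcof : ∃ Γ0 : Set X, #Γ0 ≤ ℵ_ 1 ∧ ∀ x, ∃ u ∈ Γ0, x < u) (hCH : 𝔠 ≤ (ℵ_ 1 : Cardinal.{0})) :
    Core M := by
  classical
  obtain ⟨p0, hp0, Γ, hΓ, hA⟩ := Sys.lemmaA huniv hcof
  let J : Type := W × ℕ × {γ : X // γ ∈ Γ ∧ Dir γ}
  have hω : (ℵ₀ : Cardinal.{0}) ≤ ℵ_ 1 := aleph0_lt_aleph_one'.le
  have hmul : ∀ c d : Cardinal.{0}, c ≤ ℵ_ 1 → d ≤ ℵ_ 1 → c * d ≤ ℵ_ 1 := fun c d h1 h2 =>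
    (mul_le_mul' h1 h2).trans (Cardinal.mul_eq_self hω).le
  have hJ1 : #J ≤ ℵ_ 1 := by
    show #(W × ℕ × {γ : X // γ ∈ Γ ∧ Dir γ}) ≤ ℵ_ 1
    rw [Cardinal.mk_prod, Cardinal.lift_id, Cardinal.lift_id, Cardinal.mk_prod,
          Cardinal.lift_id, Cardinal.lift_id]
    refine hmul _ _ mk_W.le (hmul _ _ ?_ ?_)
    · rw [Cardinal.mk_nat]; exact hω
    · exact (Cardinal.mk_le_mk_of_subset (s := {γ | γ ∈ Γ ∧ Dir γ}) (t := Γ) fun _ h => h.1).trans hΓ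
  have hJ : #(ℕ → J) ≤ ℵ_ 1 := by
    have h1 : #(ℕ → J) = #J ^ ℵ₀ := by simp
    rw [h1]
    refine (Cardinal.power_le_power_right (hJ1.trans Cardinal.aleph_one_le_continuum)).trans ?_
    rw [Cardinal.continuum_power_aleph0]
    exact hCH
  let γ : J → X := fun j => j.2.2.1
  have hγ : ∀ j : J, Dir (γ j) := fun j => j.2.2.2.2
  have hcol := fun a : ℕ → J => coloring (fun n => γ (a n)) (fun n => hγ _)
  choose col hcol using hcol
  let Q : Type := {c : M.Cond // M.Le c.q p0}
  have hj : ∀ c : Q, ∃ j : J, M.Full c.1.q j.1 j.2.1 (γ j) := by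
    intro c
    obtain ⟨i, n, g, h1, h2, h3⟩ := hA c.1.q c.1.big c.2
    exact ⟨(i, n, ⟨g, h1, h2⟩), h3⟩
  choose jQ hjQ using hj
  have hext : ∀ (c : Q) (β : X), ∃ d : Q, d.1.le c.1 ∧ (β < γ (jQ c) →
      (jQ c).1 ∈ d.1.S ∧ β ≤ d.1.σ (jQ c).1 (jQ c).2.1 ∧ d.1.σ (jQ c).1 (jQ c).2.1 < γ (jQ c)) := by
    intro c β
    by_cases hβ : β < γ (jQ c)
    · obtain ⟨y, h1, h2, e, h3, h4, h5⟩ := hjQ c β hβ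
      obtain ⟨d, hd1, hd2⟩ := Sys.glue (fun b : Bool => if b then c.1 else e) e.q e.big (by
        intro b; cases b
        · exact Sys.Le.refl _
        · exact h3)
      have hdc : d.le c.1 := ⟨by rw [hd1]; exact h3, by
        rw [hd2]; exact subset_iUnion (fun b : Bool => (if b then c.1 else e).S) true⟩
      have hde : d.le e := ⟨by rw [hd1]; exact Sys.Le.refl _, by
        rw [hd2]; exact subset_iUnion (fun b : Bool => (if b then c.1 else e).S) false⟩
      refine ⟨⟨d, hdc.1.trans c.2⟩, hdc, fun _ => ⟨hde.2 h4, ?_⟩⟩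
      show β ≤ d.σ (jQ c).1 (jQ c).2.1 ∧ d.σ (jQ c).1 (jQ c).2.1 < γ (jQ c)
      rw [hde.agree h4, h5]
      exact ⟨h1, h2⟩
    · exact ⟨c, Sys.Cond.le.refl _, fun h => absurd h hβ⟩
  choose ext hext1 hext2 using hext
  refine ⟨p0, hp0, ℕ → J, hJ, fun ε a => {q | ∃ c : M.Cond, c.q = q ∧ (∀ n, (a n).1 ∈ c.S) ∧
    col a (fun n => c.σ (a n).1 (a n).2.1) = ε}, ?_, ?_⟩
  · rintro ε ε' a _ _ ⟨c, rfl, h1, rfl⟩ ⟨d, rfl, h2, rfl⟩ hb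
    congr 1
    funext n
    rw [Sys.Cond.agree c d hb (h1 n) (h2 n)]
  · intro ε p hp hpp
    let node : List X → Q := fun l => List.rec
      (⟨Sys.triv p hp, Sys.Le.of_subset hpp⟩ : Q) (fun β _ v => ext v β) l
    have hnode : ∀ β l, node (β :: l) = ext (node l) β := fun _ _ => rfl
    obtain ⟨a, T, hT0, hT⟩ := exists_tree γ (fun l => jQ (node l)) hγ hJ
    let val : List X → X := fun l => (node l).1.σ (a (l.length - 1)).1 (a (l.length - 1)).2.1
    obtain ⟨y, hy1, hy2⟩ := hcol a {l | l ∈ T ∧ ∀ β l0, l = β :: l0 → β < γ (jQ (node l0))} val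
      ⟨hT0, by simp⟩ (by
        rintro l ⟨hl, -⟩ β hβ
        obtain ⟨h1, h2⟩ := hT l hl
        rw [← h1] at hβ
        obtain ⟨β', h3, h4, h5⟩ := h2 β hβ
        obtain ⟨h6, h7, h8⟩ := hext2 (node l) β' h4
        have hv : val (β' :: l) = (ext (node l) β').1.σ (jQ (node l)).1 (jQ (node l)).2.1 := by
          show (node (β' :: l)).1.σ (a ((β' :: l).length - 1)).1 (a ((β' :: l).length - 1)).2.1 = _
          rw [List.length_cons, Nat.add_sub_cancel, ← h1, hnode]
        refine ⟨β', ⟨h5, ?_⟩, ?_, ?_⟩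
        · intro b l0 hbl
          simp only [List.cons.injEq] at hbl
          rw [← hbl.1, ← hbl.2]; exact h4
        · rw [hv]; exact h3.trans h7
        · rw [hv, ← h1]; exact h8) ε
    have hjy : ∀ n, jQ (node (pre y n)) = a n := by
      intro n
      have := (hT _ (hy1 n).1).1
      rw [pre_length] at this
      exact this
    obtain ⟨d, hd1, hd2⟩ := Sys.fuse (fun n => (node (pre y n)).1) (fun n => hext1 _ _)
    have hin : ∀ n, (a n).1 ∈ (node (pre y (n+1))).1.S := by
      intro n
      have := (hext2 (node (pre y n)) (y n) ((hy1 (n+1)).2 _ _ rfl)).1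
      rw [hjy] at this
      exact this
    refine ⟨a, d.q, ⟨d, rfl, fun n => (hd2 (n+1)).2 (hin n), ?_⟩, d.big, hd1⟩
    rw [← hy2]
    congr 1
    funext n
    show _ = (node (pre y (n+1))).1.σ (a ((pre y (n+1)).length - 1)).1 (a ((pre y (n+1)).length - 1)).2.1
    rw [pre_length, Nat.add_sub_cancel, (hd2 (n+1)).agree (hin n)]

end BN

namespace BN
set_option linter.unusedSectionVars false
set_option linter.deprecated false

lemma exists_sys (μ : Cardinal.{0}) (hinf : ℵ₀ < μ) (hcof : μ.ord.cof = ℵ₀) :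
    ∃ M : Sys μ.ord.ToType, M.μ = μ ∧ M.Big Set.univ ∧
      ∃ Γ0 : Set μ.ord.ToType, #Γ0 ≤ ℵ_ 1 ∧ ∀ x, ∃ u ∈ Γ0, x < u := by
  classical
  have h1 : ℵ_ 1 < μ := by
    have : (ℵ_ 1 : Cardinal.{0}) ≤ μ := by
      rw [← Cardinal.succ_aleph0]; exact Order.succ_le_of_lt hinf
    refine lt_of_le_of_ne this ?_
    rintro rfl
    rw [Cardinal.isRegular_aleph_one.cof_ord] at hcof
    exact absurd hcof aleph0_lt_aleph_one'.ne'
  let Λ := μ.ord.ToType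
  have hΛ : #Λ = μ := Cardinal.mk_ord_toType μ
  obtain ⟨S, hS, hSc⟩ := Order.exists_cof_eq Λ
  rw [Ordinal.cof_toType, hcof] at hSc
  have hSne : S.Nonempty := by
    rw [nonempty_iff_ne_empty]; rintro rfl
    rw [Cardinal.mk_emptyCollection] at hSc
    exact aleph0_pos.ne hSc
  have hScount : S.Countable := Cardinal.le_aleph0_iff_set_countable.mp hSc.le
  obtain ⟨t, ht⟩ := hScount.exists_eq_range hSne
  have htc : ∀ x : Λ, ∃ k, x ≤ t k := by
    intro x
    obtain ⟨s, hs, hle⟩ := hS x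
    rw [ht] at hs
    obtain ⟨k, rfl⟩ := hs
    exact ⟨k, hle⟩
  have hIic : ∀ x : Λ, #(Iic x) < μ := by
    intro x
    rw [← Iio_insert]
    exact (Cardinal.mk_insert_le).trans_lt (Cardinal.add_lt_of_lt hinf.le
      (Cardinal.mk_Iio_toType_ord_lt x) (Cardinal.one_lt_aleph0.trans hinf))
  let m : ℕ → Cardinal.{0} := fun k => ℵ_ 1 ⊔ (Finset.range (k+1)).sup fun j => #(Iic (t j))
  have hm1 : ∀ k, #(Iic (t k)) ≤ m k := fun k =>
    (Finset.le_sup (f := fun j => #(Iic (t j))) (Finset.mem_range.mpr (Nat.lt_succ_self k))).trans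
      le_sup_right
  let M : Sys Λ :=
    { μ := μ
      m := m
      bl := fun x => Nat.find (htc x)
      hm0 := le_sup_left
      hmono := fun i j hij => sup_le_sup le_rfl
        (Finset.sup_mono (Finset.range_mono (by omega)))
      hlt := fun k => by
        refine max_lt h1 ?_
        rw [Finset.sup_lt_iff (by exact aleph0_pos.trans hinf)]
        exact fun j _ => hIic _
      hcof := fun c hc => by
        by_contra! hcon
        have hu : (⋃ k, Iic (t k)) = Set.univ := eq_univ_of_forall fun x => by
          obtain ⟨k, hk⟩ := htc x; exact mem_iUnion.mpr ⟨k, hk⟩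
        have h2 : #(⋃ k, Iic (t k) : Set Λ) ≤ ℵ₀ * c := by
          refine (Cardinal.mk_iUnion_le _).trans (mul_le_mul' ?_ (ciSup_le' fun k => ?_))
          · rw [Cardinal.mk_nat]
          · exact (hm1 k).trans (hcon k)
        rw [hu, Cardinal.mk_univ, hΛ] at h2
        exact absurd h2 (not_le.mpr (Cardinal.mul_lt_of_lt hinf.le hinf hc))
      hbl := fun n => by
        refine (Cardinal.mk_le_mk_of_subset (t := Iic (t n)) ?_).trans_lt (hIic (t n))
        rintro x rfl
        exact Nat.find_spec (htc x) }
  refine ⟨M, rfl, ?_, range t, ?_, ?_⟩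
  · show μ ≤ #(Set.univ : Set Λ)
    rw [Cardinal.mk_univ, hΛ]
  · exact ((Cardinal.le_aleph0_iff_set_countable).mpr (countable_range _)).trans
      aleph0_lt_aleph_one'.le
  · intro x
    have : ∃ y, y ∉ Iic x := by
      by_contra! hc
      have h2 := hIic x
      rw [eq_univ_of_forall hc, Cardinal.mk_univ, hΛ] at h2
      exact lt_irrefl _ h2
    obtain ⟨y, hy⟩ := this
    obtain ⟨k, hk⟩ := htc y
    exact ⟨t k, mem_range_self k, (not_le.mp hy).trans_le hk⟩

lemma exists_core (μ : Cardinal.{0}) (hinf : ℵ₀ < μ) (hcof : μ.ord.cof = ℵ₀) :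
    ∃ M : Sys μ.ord.ToType, M.μ = μ ∧ Core M := by
  obtain ⟨M, h1, h2, h3⟩ := exists_sys μ hinf hcof
  refine ⟨M, h1, ?_⟩
  by_cases hc : (ℵ_ 2 : Cardinal.{0}) ≤ 𝔠
  · exact case2 M h2 hc
  · refine case1 M h2 h3 ?_
    have : (ℵ_ 2 : Cardinal.{0}) = Order.succ (ℵ_ 1) := by
      rw [← Cardinal.aleph_succ]; congr 1
      rw [← Ordinal.add_one_eq_succ]; norm_num
    rw [not_le, this] at hc
    exact Order.lt_succ_iff.mp hc

def Sys.pull {X Y : Type} (e : X ≃ Y) (M : Sys Y) : Sys X where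
  μ := M.μ
  m := M.m
  bl := fun x => M.bl (e x)
  hm0 := M.hm0
  hmono := M.hmono
  hlt := M.hlt
  hcof := M.hcof
  hbl := fun n => by
    have : {x | M.bl (e x) = n} = e ⁻¹' {y | M.bl y = n} := rfl
    rw [this]
    exact (Cardinal.mk_preimage_of_injective _ _ e.injective).trans_lt (M.hbl n)

section top
variable {X : Type} (M : Sys X)

lemma Sys.big_eq (hX : #X = M.μ) {q : Set X} : M.Big q ↔ #q = M.μ :=
  ⟨fun h => le_antisymm (hX ▸ Cardinal.mk_set_le q) h, fun h => h.ge⟩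

lemma exists_uf (hX : #X = M.μ) {ι : Type} [LinearOrder ι] [Nonempty ι] (p : ι → Set X) (hp : ∀ i, M.Big (p i))
    (hle : ∀ i j, i ≤ j → M.Le (p j) (p i)) : ∃ F : UnifUF X M.μ, ∀ i, p i ∈ F.1 := by
  let G : Filter X :=
    { sets := {s | ∃ i, M.Le (p i) s}
      univ_sets := ⟨Classical.arbitrary ι, Sys.Le.of_subset (subset_univ _)⟩
      sets_of_superset := by
        rintro s t ⟨i, hi⟩ hst
        exact ⟨i, hi.trans (Sys.Le.of_subset hst)⟩
      inter_sets := by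
        rintro s t ⟨i, hi⟩ ⟨j, hj⟩
        refine ⟨max i j, ?_⟩
        have h1 := (hle i _ (le_max_left i j)).trans hi
        have h2 := (hle j _ (le_max_right i j)).trans hj
        refine (Sys.Small.union h1 h2).mono ?_
        rintro x ⟨hx, hn⟩
        by_cases hs : x ∈ s
        · exact Or.inr ⟨hx, fun ht => hn ⟨hs, ht⟩⟩
        · exact Or.inl ⟨hx, hs⟩ }
  have hG : ∀ s, s ∈ G ↔ ∃ i, M.Le (p i) s := fun _ => Iff.rfl
  have hne : G.NeBot := by
    rw [Filter.neBot_iff]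
    intro hb
    have : ∅ ∈ G := by rw [hb]; exact Filter.mem_bot
    obtain ⟨i, hi⟩ := (hG _).mp this
    exact Sys.not_big.mpr (Sys.small_empty.of_le hi) (hp i)
  refine ⟨⟨Ultrafilter.of G, fun s hs => ?_⟩, fun i => Ultrafilter.of_le G ((hG _).mpr ⟨i, Sys.Le.refl _⟩)⟩
  rw [← Sys.big_eq M hX]
  by_contra hb
  have hsm := Sys.not_big.mp hb
  have hsc : sᶜ ∈ Ultrafilter.of G := by
    refine Ultrafilter.of_le G ((hG _).mpr ⟨Classical.arbitrary ι, hsm.mono ?_⟩)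
    rintro x ⟨_, hx⟩
    exact not_not.mp hx
  exact (Ultrafilter.compl_notMem_iff.mpr hs) hsc

lemma exists_uf' (hX : #X = M.μ) (p : Set X) (hp : M.Big p) : ∃ F : UnifUF X M.μ, p ∈ F.1 := by
  obtain ⟨F, hF⟩ := exists_uf M hX (ι := ℕ) (fun _ => p) (fun _ => hp) (fun _ _ _ => Sys.Le.refl _)
  exact ⟨F, hF 0⟩

lemma isOpen_hat (p : Set X) (hp : #p = M.μ) : IsOpen {F : UnifUF X M.μ | p ∈ F.1} :=
  TopologicalSpace.GenerateOpen.basic _ ⟨p, hp, rfl⟩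

lemma open_nhd (U : Set (UnifUF X M.μ)) (hU : IsOpen U) :
    ∀ F ∈ U, ∃ p ∈ F.1, {G : UnifUF X M.μ | p ∈ G.1} ⊆ U := by
  induction hU with
  | basic s hs =>
    obtain ⟨p, hp, rfl⟩ := hs
    intro F hF
    exact ⟨p, hF, subset_rfl⟩
  | univ => intro F _; exact ⟨Set.univ, Filter.univ_mem, subset_univ _⟩
  | inter s t _ _ ih1 ih2 =>
    rintro F ⟨h1, h2⟩
    obtain ⟨p, hp, hps⟩ := ih1 F h1
    obtain ⟨q, hq, hqs⟩ := ih2 F h2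
    refine ⟨p ∩ q, Filter.inter_mem hp hq, fun G hG => ⟨hps ?_, hqs ?_⟩⟩
    · exact Filter.mem_of_superset hG inter_subset_left
    · exact Filter.mem_of_superset hG inter_subset_right
  | sUnion S _ ih =>
    rintro F ⟨s, hs, hF⟩
    obtain ⟨p, hp, hps⟩ := ih s hs F hF
    exact ⟨p, hp, hps.trans (subset_sUnion_of_mem hs)⟩

lemma nd_of (hX : #X = M.μ) (N : Set (UnifUF X M.μ))
    (h : ∀ p, M.Big p → ∃ q ⊆ p, M.Big q ∧ ∀ F ∈ N, q ∉ F.1) : IsNowhereDense N := by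
  unfold IsNowhereDense
  rw [← not_nonempty_iff_eq_empty]
  rintro ⟨F, hF⟩
  obtain ⟨p, hp, hps⟩ := open_nhd M _ isOpen_interior F hF
  obtain ⟨q, hqp, hq, hqN⟩ := h p ((Sys.big_eq M hX).mpr (F.2 p hp))
  obtain ⟨G, hG⟩ := exists_uf' M hX q hq
  have hGc : G ∈ closure N := interior_subset (hps (show p ∈ G.1 from Filter.mem_of_superset hG hqp))
  obtain ⟨H, h1, h2⟩ := mem_closure_iff.mp hGc _ (isOpen_hat M q ((Sys.big_eq M hX).mp hq)) hG
  exact hqN H h2 h1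

lemma of_nd (hX : #X = M.μ) (N : Set (UnifUF X M.μ)) (hN : IsNowhereDense N) (p : Set X) (hp : M.Big p) :
    ∃ q ⊆ p, M.Big q ∧ ∀ F ∈ N, q ∉ F.1 := by
  have hpo := isOpen_hat M p ((Sys.big_eq M hX).mp hp)
  have : ¬ {F : UnifUF X M.μ | p ∈ F.1} ⊆ closure N := by
    intro hsub
    obtain ⟨F, hF⟩ := exists_uf' M hX p hp
    have h1 : F ∈ interior (closure N) := interior_maximal hsub hpo hF
    unfold IsNowhereDense at hN
    rw [hN] at h1
    exact h1
  obtain ⟨F, hF, hFn⟩ := not_subset.mp this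
  obtain ⟨q, hq, hqs⟩ := open_nhd M _ (isClosed_closure (s := N)).isOpen_compl F hFn
  have hqp : q ∩ p ∈ F.1 := Filter.inter_mem hq hF
  refine ⟨q ∩ p, inter_subset_right, (Sys.big_eq M hX).mpr (F.2 _ hqp), fun G hG hm => ?_⟩
  exact hqs (show q ∈ G.1 from Filter.mem_of_superset hm inter_subset_left) (subset_closure hG)

/-- the lower bound -/
lemma lower (hX : #X = M.μ) (S : Set (Set (UnifUF X M.μ))) (hS : ∀ s ∈ S, IsNowhereDense s)
    (hcov : ⋃₀ S = Set.univ) : ℵ_ 2 ≤ #S := by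
  by_contra hlt
  have hS1 : #S ≤ ℵ_ 1 := by
    have : (ℵ_ 2 : Cardinal.{0}) = Order.succ (ℵ_ 1) := by
      rw [← Cardinal.aleph_succ]; congr 1
      rw [← Ordinal.add_one_eq_succ]; norm_num
    rw [not_le, this] at hlt
    exact Order.lt_succ_iff.mp hlt
  have huniv : M.Big Set.univ := by rw [Sys.big_eq M hX, Cardinal.mk_univ, hX]
  obtain ⟨F0, -⟩ := exists_uf' M hX _ huniv
  have hSne : Nonempty S := by
    have : F0 ∈ ⋃₀ S := by rw [hcov]; exact mem_univ _
    obtain ⟨s, hs, -⟩ := this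
    exact ⟨⟨s, hs⟩⟩
  rw [← mk_W] at hS1
  obtain ⟨f⟩ := hS1
  let N : W → S := Function.invFun f
  have hN : Function.Surjective N := Function.invFun_surjective f.injective
  have step : ∀ (α : W) (h : ∀ β : W, β < α → Set X), ∃ q, (∀ β hβ, M.Big (h β hβ)) →
      (∀ β hβ β' hβ', β' ≤ β → M.Le (h β hβ) (h β' hβ')) →
      M.Big q ∧ (∀ β hβ, M.Le q (h β hβ)) ∧ ∀ F ∈ (N α).1, q ∉ F.1 := by
    intro α h
    by_cases hh : (∀ β hβ, M.Big (h β hβ)) ∧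
      (∀ β hβ β' hβ', β' ≤ β → M.Le (h β hβ) (h β' hβ'))
    · obtain ⟨h1, h2⟩ := hh
      have hr : ∃ r, M.Big r ∧ ∀ β hβ, M.Le r (h β hβ) := by
        by_cases hne : Nonempty (Iio α)
        · have : Countable (Iio α) := (W_countable_Iio α).to_subtype
          obtain ⟨g, hg⟩ := exists_surjective_nat (Iio α)
          let g' : ℕ → Iio α := fun k => partialSups g k
          obtain ⟨r, -, hr, hrl⟩ := Sys.lower_bound (M := M) (fun k => h (g' k).1 (g' k).2)
            (fun k => h1 _ _) (fun k => h2 _ _ _ _ ((partialSups g).monotone (Nat.le_succ k)))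
          refine ⟨r, hr, fun β hβ => ?_⟩
          obtain ⟨k, hk⟩ := hg ⟨β, hβ⟩
          refine (hrl k).trans (h2 _ _ _ _ ?_)
          have h3 : g k ≤ g' k := le_partialSups g k
          rw [hk] at h3
          exact h3
        · exact ⟨Set.univ, huniv, fun β hβ => absurd ⟨⟨β, hβ⟩⟩ hne⟩
      obtain ⟨r, hr, hrl⟩ := hr
      obtain ⟨q, hqr, hq, hqN⟩ := of_nd M hX _ (hS _ (N α).2) r hr
      exact ⟨q, fun _ _ => ⟨hq, fun β hβ => (Sys.Le.of_subset hqr).trans (hrl β hβ), hqN⟩⟩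
    · exact ⟨∅, fun h1 h2 => absurd ⟨h1, h2⟩ hh⟩
  choose Fn hFn using step
  let p : W → Set X := (wellFounded_lt (α := W)).fix Fn
  have hp : ∀ j, p j = Fn j (fun k _ => p k) := fun j => WellFounded.fix_eq _ _ _
  have key : ∀ α, M.Big (p α) ∧ (∀ β < α, M.Le (p α) (p β)) ∧ ∀ F ∈ (N α).1, p α ∉ F.1 := by
    intro α
    induction α using WellFoundedLT.induction with
    | _ α ih =>
    rw [hp α]
    refine hFn α (fun k _ => p k) (fun β hβ => (ih β hβ).1) (fun β hβ β' hβ' hle => ?_)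
    rcases hle.eq_or_lt with rfl | hlt
    · exact Sys.Le.refl _
    · exact (ih β hβ).2.1 β' hlt
  have : Nonempty W := by
    obtain ⟨a, -⟩ := W_bound (countable_empty); exact ⟨a⟩
  obtain ⟨F, hF⟩ := exists_uf M hX p (fun α => (key α).1) (fun i j hij => by
    rcases hij.eq_or_lt with rfl | hlt
    · exact Sys.Le.refl _
    · exact (key j).2.1 i hlt)
  have : F ∈ ⋃₀ S := by rw [hcov]; exact mem_univ _
  obtain ⟨s, hs, hFs⟩ := this
  obtain ⟨α, hα⟩ := hN ⟨s, hs⟩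
  exact (key α).2.2 F (by rw [hα]; exact hFs) (hF α)

/-- the upper bound -/
lemma upper (hX : #X = M.μ) {Y : Type} (M' : Sys Y) (hμ : M'.μ = M.μ) (hY : #Y = M.μ) (hcore : Core M') :
    ∃ S : Set (Set (UnifUF X M.μ)), #S ≤ ℵ_ 2 ∧ (∀ s ∈ S, IsNowhereDense s) ∧
      ⋃₀ S = Set.univ := by
  obtain ⟨p0, hp0, K, hK, E, hE1, hE2⟩ := hcore
  have hp0c : #p0 = M'.μ := (Sys.big_eq M' (by rw [hY, hμ])).mp hp0
  obtain ⟨g⟩ : Nonempty (X ≃ p0) := by rw [← Cardinal.eq, hX, hp0c, hμ]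
  let gv : X → Y := fun x => (g x).1
  have hgi : Function.Injective gv := Subtype.val_injective.comp g.injective
  have hgr : range gv = p0 := by
    ext y; constructor
    · rintro ⟨x, rfl⟩; exact (g x).2
    · intro hy; exact ⟨g.symm ⟨y, hy⟩, by simp [gv]⟩
  let N : Om2 → Set (UnifUF X M.μ) := fun ε => {F | ∀ k, ∀ q ∈ E ε k, gv ⁻¹' q ∉ F.1}
  refine ⟨range N, Cardinal.mk_range_le.trans mk_Om2.le, ?_, ?_⟩
  · rintro _ ⟨ε, rfl⟩
    refine nd_of M hX _ fun p hp => ?_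
    have hgp : M'.Big (gv '' p) := by
      show M'.μ ≤ _
      rw [Cardinal.mk_image_eq hgi, hμ]; exact hp
    obtain ⟨k, q, hqE, hq, hqp⟩ := hE2 ε (gv '' p) hgp (by rw [← hgr]; exact image_subset_range _ _)
    refine ⟨gv ⁻¹' q, ?_, ?_, fun F hF => hF k q hqE⟩
    · rw [← preimage_image_eq p hgi]; exact preimage_mono hqp
    · show M.μ ≤ _
      rw [Cardinal.mk_preimage_of_injective_of_subset_range gv q hgi
        (hqp.trans (image_subset_range _ _)), ← hμ]
      exact hq
  · refine eq_univ_of_forall fun F => ?_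
    by_contra hF
    have : ∀ ε, ∃ k, ∃ q ∈ E ε k, gv ⁻¹' q ∈ F.1 := by
      intro ε
      by_contra! hc
      exact hF ⟨N ε, mem_range_self ε, hc⟩
    choose k q hq hqF using this
    have hinj : Function.Injective k := by
      intro ε ε' he
      refine hE1 ε ε' (k ε) (q ε) (q ε') (hq ε) (he ▸ hq ε') ?_
      have h1 : gv ⁻¹' (q ε ∩ q ε') ∈ F.1 := Filter.inter_mem (hqF ε) (hqF ε')
      have h2 := F.2 _ h1
      show M'.μ ≤ _
      rw [hμ, ← h2]
      exact Cardinal.mk_preimage_of_injective gv _ hgi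
    have h3 := (Cardinal.mk_le_of_injective hinj).trans hK
    rw [mk_Om2] at h3
    exact absurd h3 (not_le.mpr (Cardinal.aleph_lt_aleph.mpr (by norm_num)))

end top

end BN

/-- for `μ` singular of cofinality `ω`, the Baire number of the
space `U(μ)` of uniform ultrafilters over `μ` — the least number of
nowhere-dense sets needed to cover it — equals `ω₂`. -/
theorem stmt_17 (μ : Cardinal.{0}) (hinf : Cardinal.aleph0 < μ)
    (hcof : μ.ord.cof = Cardinal.aleph0)
    (X : Type) (hX : Cardinal.mk X = μ) :
    sInf {c : Cardinal.{0} | ∃ S : Set (Set (UnifUF X μ)),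
      Cardinal.mk S = c ∧ (∀ s ∈ S, IsNowhereDense s) ∧ ⋃₀ S = Set.univ} =
      Cardinal.aleph 2 := by
  obtain ⟨M', hμ, hcore⟩ := BN.exists_core μ hinf hcof
  have hY : #(μ.ord.ToType) = μ := Cardinal.mk_ord_toType μ
  obtain ⟨e⟩ : Nonempty (X ≃ μ.ord.ToType) := by rw [← Cardinal.eq, hX, hY]
  let M : BN.Sys X := BN.Sys.pull e M'
  have hM : M.μ = μ := hμ
  clear_value M
  subst hM
  obtain ⟨S, hS1, hS2, hS3⟩ := BN.upper M hX M' hμ hY hcore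
  refine le_antisymm ?_ ?_
  · refine le_trans (csInf_le' ?_) hS1
    exact ⟨S, rfl, hS2, hS3⟩
  · refine le_csInf ⟨_, S, rfl, hS2, hS3⟩ ?_
    rintro c ⟨S', rfl, h1, h2⟩
    exact BN.lower M hX S' h1 h2
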